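/- arXiv:2209.08051 — 3 statements merged into one kernel-verified Lean document; each statement's English description precedes it below -/
import Mathlib

section
/- Let ħ > 0, let n = n_A + n_B with n_A, n_B ≥ 1, and let Σ be a real symmetric positive definite 2n×2n matrix such that the complex Hermitian matrix Σ + (iħ/2)J is positive semidefinite. Then there exist a matrix U ∈ Sp(2n,ℝ) with UᵀU = I (a symplectic rotation) and matrices S_A ∈ Sp(2n_A,ℝ), S_B ∈ Sp(2n_B,ℝ) such that U Σ Uᵀ − (ħ/2)·(S_A S_Aᵀ ⊕ S_B S_Bᵀ) is positive semidefinite. (In other words, every Gaussian quantum covariance matrix can be brought to a separable one, in the Werner–Wolf sense Σ' ≥ (ħ/2)(S_A S_Aᵀ ⊕ S_B S_Bᵀ), by a symplectic rotation.) -/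
open Matrix Complex
open scoped ComplexOrder

noncomputable section

/-- The standard symplectic matrix `[[0, I],[-I, 0]]` in the `z = (x,p)` ordering,
acting on a `2m`-dimensional phase space indexed by `Fin m ⊕ Fin m`. -/
def Jmat (m : ℕ) : Matrix (Fin m ⊕ Fin m) (Fin m ⊕ Fin m) ℝ :=
  Matrix.fromBlocks 0 1 (-1) 0

/-- A real matrix is symplectic (for the symplectic form `J`) if `Sᵀ J S = J`. -/
def IsSymplectic {ι : Type*} [Fintype ι] (J S : Matrix ι ι ℝ) : Prop :=
  Sᵀ * J * S = J

/-- The phase space `ℝ^{2n} = ℝ^{2n_A} ⊕ ℝ^{2n_B}` of the bipartite system `AB`. -/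
abbrev ABIdx (nA nB : ℕ) := (Fin nA ⊕ Fin nA) ⊕ (Fin nB ⊕ Fin nB)

/-- The symplectic form on `ℝ^{2n}` is the direct sum `J = J_A ⊕ J_B` of the symplectic
forms of the two subsystems. -/
def JAB (nA nB : ℕ) : Matrix (ABIdx nA nB) (ABIdx nA nB) ℝ :=
  Matrix.fromBlocks (Jmat nA) 0 0 (Jmat nB)

/-- The complexification of a real matrix. -/
def cplx {m : Type*} (A : Matrix m m ℝ) : Matrix m m ℂ :=
  A.map (fun x => (x : ℂ))

open scoped RealInnerProductSpace in
theorem exists_symplectic_eigenvectors {E : Type*} [NormedAddCommGroup E]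
    [InnerProductSpace ℝ E] [FiniteDimensional ℝ E] (J P : E →ₗ[ℝ] E)
    (hJ : ∀ x y, ⟪J x, J y⟫ = ⟪x, y⟫) (hskew : ∀ x y, ⟪J x, y⟫ = -⟪x, J y⟫)
    (hP : P.IsSymmetric) (hPJP : ∀ x, P (J (P x)) = J x) (k : ℕ)
    (hk : 2 * k ≤ Module.finrank ℝ E) :
    ∃ (e : Fin k → E) (μ : Fin k → ℝ), (∀ i j, ⟪e i, e j⟫ = if i = j then 1 else 0) ∧
      (∀ i j, ⟪e i, J (e j)⟫ = 0) ∧ ∀ i, P (e i) = μ i • e i := by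
  induction k with
  | zero => exact ⟨Fin.elim0, Fin.elim0, fun i => i.elim0, fun i => i.elim0, fun i => i.elim0⟩
  | succ k ih =>
    obtain ⟨e, μ, he, heJ, heP⟩ := ih (by omega)
    set b : Fin k ⊕ Fin k → E := Sum.elim e (fun i => J (e i)) with hb
    set W : Submodule ℝ E := (Submodule.span ℝ (Set.range b))ᗮ with hW
    have hmem : ∀ x, x ∈ W ↔ ∀ i, ⟪e i, x⟫ = 0 ∧ ⟪J (e i), x⟫ = 0 := by
      intro x
      rw [hW, Submodule.mem_orthogonal]
      constructor
      · intro h i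
        exact ⟨h _ (Submodule.subset_span ⟨Sum.inl i, rfl⟩),
          h _ (Submodule.subset_span ⟨Sum.inr i, rfl⟩)⟩
      · intro h u hu
        induction hu using Submodule.span_induction with
        | mem y hy =>
          obtain ⟨i | i, rfl⟩ := hy
          exacts [(h i).1, (h i).2]
        | zero => exact inner_zero_left x
        | add y z _ _ hy hz => rw [inner_add_left, hy, hz, add_zero]
        | smul a y _ hy => rw [inner_smul_left, hy, mul_zero]
    have hfin : Module.finrank ℝ W ≠ 0 := by
      have h1 := Submodule.finrank_add_finrank_orthogonal (Submodule.span ℝ (Set.range b))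
      have h2 : Module.finrank ℝ (Submodule.span ℝ (Set.range b)) ≤ Fintype.card (Fin k ⊕ Fin k) :=
        finrank_range_le_card b
      simp only [Fintype.card_sum, Fintype.card_fin] at h2
      rw [← hW] at h1
      omega
    have hPJ : ∀ i, P (J (e i)) = (μ i)⁻¹ • J (e i) := by
      intro i
      have h := hPJP (e i)
      rw [heP, map_smul, map_smul] at h
      have hμ : μ i ≠ 0 := by
        intro h0
        rw [h0, zero_smul] at h
        have h3 := he i i
        rw [← hJ, ← h] at h3
        simp at h3
      rw [eq_inv_smul_iff₀ hμ, h]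
    have hinv : ∀ x ∈ W, P x ∈ W := by
      intro x hx
      rw [hmem] at hx ⊢
      intro i
      rw [← hP, ← hP, heP, hPJ, inner_smul_left, inner_smul_left, (hx i).1, (hx i).2]
      simp
    have : Nontrivial W := Module.nontrivial_of_finrank_pos (R := ℝ) (Nat.pos_of_ne_zero hfin)
    have hev := (hP.restrict_invariant hinv).hasEigenvalue_iSup_of_finiteDimensional
    obtain ⟨w, hw⟩ := hev.exists_hasEigenvector
    obtain ⟨ν, hν⟩ : ∃ ν : ℝ, P w = ν • (w : E) :=
      ⟨_, congrArg Subtype.val hw.apply_eq_smul⟩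
    have hw0 : ‖(w : E)‖ ≠ 0 := by simpa using hw.2
    set v : E := ‖(w : E)‖⁻¹ • (w : E) with hv
    have hvW := (hmem v).1 (W.smul_mem _ w.2)
    have hvv : ⟪v, v⟫ = 1 := by
      rw [real_inner_self_eq_norm_sq, hv, norm_smul, norm_inv, norm_norm, inv_mul_cancel₀ hw0,
        one_pow]
    have hvJ : ⟪v, J v⟫ = 0 := by
      have := hskew v v
      rw [real_inner_comm] at this
      linarith
    refine ⟨Fin.cons v e, Fin.cons ν μ, ?_, ?_, ?_⟩
    · intro i j
      refine Fin.cases ?_ (fun i => ?_) i <;> refine Fin.cases ?_ (fun j => ?_) j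
      · simpa using hvv
      · simpa [real_inner_comm, (Fin.succ_ne_zero _).symm] using (hvW j).1
      · simpa [Fin.succ_ne_zero] using (hvW i).1
      · simpa using he i j
    · intro i j
      refine Fin.cases ?_ (fun i => ?_) i <;> refine Fin.cases ?_ (fun j => ?_) j
      · simpa using hvJ
      · simpa [real_inner_comm] using (hvW j).2
      · simpa [hskew] using (hvW i).2
      · simpa using heJ i j
    · intro i
      refine Fin.cases ?_ (fun i => ?_) i
      · rw [Fin.cons_zero, Fin.cons_zero, hv, map_smul, hν, smul_comm]
      · simpa using heP i

theorem posSemidef_of_dotProduct {ι : Type*} [Fintype ι] {M : Matrix ι ι ℝ} (hM : M.IsSymm)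
    (h : ∀ x, 0 ≤ x ⬝ᵥ M *ᵥ x) : M.PosSemidef :=
  .of_dotProduct_mulVec_nonneg (by rwa [IsHermitian, conjTranspose_eq_transpose_of_trivial])
    (by simpa using h)

open scoped MatrixOrder in
theorem exists_symplectic_le {ι : Type*} [Fintype ι] [DecidableEq ι] {J σ : Matrix ι ι ℝ}
    (hJt : Jᵀ = -J) (hJJ : J * J = -1) (hσ : σ.PosDef)
    (h : ∀ u v, 0 ≤ u ⬝ᵥ σ *ᵥ u + v ⬝ᵥ σ *ᵥ v - 2 * (u ⬝ᵥ J *ᵥ v)) :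
    ∃ P : Matrix ι ι ℝ, P.PosSemidef ∧ P * J * P = J ∧ (σ - P).PosSemidef := by
  obtain ⟨R, hRs, hRR⟩ : ∃ R : Matrix ι ι ℝ, R.IsSymm ∧ R * R = σ := by
    refine ⟨CFC.sqrt σ, ?_, CFC.sqrt_mul_sqrt_self σ hσ.posSemidef.nonneg⟩
    simpa [IsHermitian, IsSymm] using (CFC.sqrt_nonneg σ).posSemidef.isHermitian
  have hRu : IsUnit R := by
    have := hσ.isUnit
    rw [← hRR] at this
    exact isUnit_of_mul_isUnit_left this
  obtain ⟨Q, hRQ, hQR⟩ : ∃ Q, R * Q = 1 ∧ Q * R = 1 := by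
    obtain ⟨r, rfl⟩ := hRu
    exact ⟨↑r⁻¹, r.mul_inv, r.inv_mul⟩
  have hQs : Qᵀ = Q := by
    have h1 : Qᵀ * R = 1 := by
      have := congrArg transpose hRQ
      rwa [transpose_mul, hRs.eq, transpose_one] at this
    calc Qᵀ = Qᵀ * (R * Q) := by rw [hRQ, mul_one]
      _ = Q := by rw [← mul_assoc, h1, one_mul]
  set L := Q * J * Q with hL
  have hLt : Lᵀ = -L := by
    rw [hL, transpose_mul, transpose_mul, hQs, hJt]; noncomm_ring
  have hbound : ∀ x, (L *ᵥ x) ⬝ᵥ (L *ᵥ x) ≤ x ⬝ᵥ x := by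
    intro x
    have h1 := h (Q *ᵥ (L *ᵥ x)) (Q *ᵥ x)
    have key : ∀ a b, (Q *ᵥ a) ⬝ᵥ σ *ᵥ (Q *ᵥ b) = a ⬝ᵥ b := by
      intro a b
      rw [dotProduct_comm, dotProduct_mulVec, ← mulVec_transpose, hQs, dotProduct_comm,
        mulVec_mulVec, mulVec_mulVec, ← hRR]
      rw [show Q * (R * R) * Q = Q * R * (R * Q) by noncomm_ring, hRQ, hQR, one_mul, one_mulVec]
    have key2 : (Q *ᵥ (L *ᵥ x)) ⬝ᵥ J *ᵥ (Q *ᵥ x) = (L *ᵥ x) ⬝ᵥ (L *ᵥ x) := by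
      rw [dotProduct_comm, dotProduct_mulVec, ← mulVec_transpose, hQs, dotProduct_comm,
        mulVec_mulVec, mulVec_mulVec, ← hL]
    rw [key, key, key2] at h1
    linarith
  have hLL : (Lᵀ * L).PosSemidef := by
    simpa using posSemidef_conjTranspose_mul_self L
  obtain ⟨A, hA, hAA, hcomm⟩ : ∃ A : Matrix ι ι ℝ, A.PosSemidef ∧ A * A = Lᵀ * L ∧
      Commute A L := by
    refine ⟨CFC.sqrt (Lᵀ * L), (CFC.sqrt_nonneg _).posSemidef,
      CFC.sqrt_mul_sqrt_self _ hLL.nonneg, ?_⟩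
    refine Commute.cfcₙ_nnreal ?_ _
    rw [hLt]
    exact (((Commute.refl L).neg_left).mul_left (Commute.refl L))
  have hAs : Aᵀ = A := by simpa [IsHermitian] using hA.isHermitian
  have hA1 : (1 - A).PosSemidef := by
    refine posSemidef_of_dotProduct (by simp [IsSymm, hAs]) fun x => ?_
    have h1 : (A *ᵥ x) ⬝ᵥ (A *ᵥ x) ≤ x ⬝ᵥ x := by
      refine le_trans (le_of_eq ?_) (hbound x)
      have key : ∀ M : Matrix ι ι ℝ, (M *ᵥ x) ⬝ᵥ (M *ᵥ x) = x ⬝ᵥ (Mᵀ * M) *ᵥ x := by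
        intro M
        rw [← mulVec_mulVec, dotProduct_mulVec x, vecMul_transpose]
      rw [key, key, hAs, hAA]
    have h2 : 0 ≤ (x - A *ᵥ x) ⬝ᵥ (x - A *ᵥ x) := by
      simpa using dotProduct_star_self_nonneg (x - A *ᵥ x)
    rw [sub_mulVec, one_mulVec, dotProduct_sub]
    simp only [dotProduct_sub, sub_dotProduct, dotProduct_comm (A *ᵥ x) x] at h2
    linarith
  refine ⟨R * A * R, ?_, ?_, ?_⟩
  · simpa [hRs.eq] using hA.conjTranspose_mul_mul_same R
  · have hJ : J = R * L * R := by
      have : R * L * R = (R * Q) * J * (Q * R) := by rw [hL]; noncomm_ring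
      rw [this, hRQ, hQR, one_mul, mul_one]
    have hQJ : L * (R * J * R) = -1 := by
      calc L * (R * J * R) = Q * J * (Q * R) * J * R := by rw [hL]; noncomm_ring
        _ = Q * (J * J) * R := by rw [hQR]; noncomm_ring
        _ = -1 := by rw [hJJ, mul_neg, mul_one, neg_mul, hQR]
    calc R * A * R * J * (R * A * R) = R * (A * (R * J * R) * A) * R := by noncomm_ring
      _ = R * L * R := by
        congr 2
        have hinv := mul_eq_one_comm.1 (show L * (-(R * J * R)) = 1 by rw [mul_neg, hQJ, neg_neg])
        calc A * (R * J * R) * A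
            = A * (R * J * R) * A * (L * (-(R * J * R))) := by rw [mul_neg L, hQJ]; simp
          _ = A * (R * J * R) * (A * L) * (-(R * J * R)) := by noncomm_ring
          _ = -(A * (-(R * J * R) * L) * A * (-(R * J * R))) := by
            rw [hcomm.eq]; noncomm_ring
          _ = L * (L * (-(R * J * R))) := by
            rw [hinv, mul_one, hAA, hLt]; noncomm_ring
          _ = L := by rw [mul_neg L, hQJ]; simp
      _ = J := hJ.symm
  · have := hA1.conjTranspose_mul_mul_same R
    convert this using 1
    rw [conjTranspose_eq_transpose_of_trivial, hRs.eq, ← hRR]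
    noncomm_ring

theorem exists_symplectic_eigenbasis {ι κ : Type*} [Fintype ι] [DecidableEq ι] [Fintype κ]
    [DecidableEq κ] {J P : Matrix ι ι ℝ} (hJt : Jᵀ = -J) (hJJ : J * J = -1)
    (hP : P.PosSemidef) (hPJP : P * J * P = J) (hcard : Fintype.card ι = 2 * Fintype.card κ) :
    ∃ (e : κ → ι → ℝ) (μ : κ → ℝ), (∀ i, 0 < μ i) ∧
      (∀ i j, e i ⬝ᵥ e j = if i = j then 1 else 0) ∧
      (∀ i j, e i ⬝ᵥ J *ᵥ e j = 0) ∧ (∀ i, P *ᵥ e i = μ i • e i) ∧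
      ∀ i, P *ᵥ (J *ᵥ e i) = (μ i)⁻¹ • (J *ᵥ e i) := by
  have hPs : Pᵀ = P := by simpa [IsHermitian] using hP.isHermitian
  have adj : ∀ (M : Matrix ι ι ℝ) x y, (M *ᵥ x) ⬝ᵥ y = x ⬝ᵥ Mᵀ *ᵥ y := fun M x y => by
    rw [dotProduct_mulVec, vecMul_transpose]
  have hJadj : ∀ x y, (J *ᵥ x) ⬝ᵥ y = -(x ⬝ᵥ J *ᵥ y) := fun x y => by
    rw [adj, hJt, neg_mulVec, dotProduct_neg]
  have hJiso : ∀ x y, (J *ᵥ x) ⬝ᵥ (J *ᵥ y) = x ⬝ᵥ y := fun x y => by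
    rw [hJadj, mulVec_mulVec, hJJ, neg_mulVec, one_mulVec, dotProduct_neg, neg_neg]
  have hin : ∀ x y : EuclideanSpace ℝ ι, inner ℝ x y = x.ofLp ⬝ᵥ y.ofLp := fun x y => by
    rw [EuclideanSpace.inner_eq_star_dotProduct, star_trivial, dotProduct_comm]
  obtain ⟨e, μ, he, heJ, heP⟩ := exists_symplectic_eigenvectors
    (toEuclideanLin J) (toEuclideanLin P)
    (fun x y => by simp only [hin, ofLp_toLpLin, toLin'_apply, hJiso])
    (fun x y => by simp only [hin, ofLp_toLpLin, toLin'_apply, hJadj])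
    (fun x y => by simp only [hin, ofLp_toLpLin, toLin'_apply, adj, hPs])
    (fun x => by
      apply (WithLp.equiv 2 _).injective
      simp [toLin'_apply, mulVec_mulVec, ← mul_assoc, hPJP])
    (Fintype.card κ) (by rw [finrank_euclideanSpace, hcard])
  let f : κ → ι → ℝ := fun i => (e (Fintype.equivFin κ i)).ofLp
  let ν : κ → ℝ := fun i => μ (Fintype.equivFin κ i)
  have hff : ∀ i j, f i ⬝ᵥ f j = if i = j then 1 else 0 := fun i j => by
    have := he (Fintype.equivFin κ i) (Fintype.equivFin κ j)
    rw [hin] at this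
    simpa [f] using this
  have hfP : ∀ i, P *ᵥ f i = ν i • f i := fun i => by
    simpa [f, ν, toLin'_apply] using congrArg WithLp.ofLp (heP (Fintype.equivFin κ i))
  have hν : ∀ i, 0 < ν i ∧ P *ᵥ (J *ᵥ f i) = (ν i)⁻¹ • (J *ᵥ f i) := fun i => by
    have h1 : ν i • (P *ᵥ (J *ᵥ f i)) = J *ᵥ f i := by
      rw [← mulVec_smul, ← mulVec_smul, ← hfP, mulVec_mulVec, mulVec_mulVec, hPJP]
    have h2 : 0 ≤ ν i := by
      simpa [hfP, hff] using hP.dotProduct_mulVec_nonneg (f i)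
    have h3 : ν i ≠ 0 := fun h0 => by
      have h4 := hJiso (f i) (f i)
      rw [← h1, h0, hff] at h4
      simp at h4
    exact ⟨lt_of_le_of_ne h2 h3.symm, by rw [eq_inv_smul_iff₀ h3, h1]⟩
  refine ⟨f, ν, fun i => (hν i).1, hff, fun i j => ?_, hfP, fun i => (hν i).2⟩
  simpa [hin, f, toLin'_apply] using heJ (Fintype.equivFin κ i) (Fintype.equivFin κ j)

theorem Jmat_transpose (m : ℕ) : (Jmat m)ᵀ = -Jmat m := by
  simp [Jmat, fromBlocks_transpose, fromBlocks_neg]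

theorem Jmat_mul_self (m : ℕ) : Jmat m * Jmat m = -1 := by
  simp [Jmat, fromBlocks_multiply, ← fromBlocks_one, fromBlocks_neg]

theorem JAB_transpose (nA nB : ℕ) : (JAB nA nB)ᵀ = -JAB nA nB := by
  simp [JAB, fromBlocks_transpose, fromBlocks_neg, Jmat_transpose]

theorem JAB_mul_self (nA nB : ℕ) : JAB nA nB * JAB nA nB = -1 := by
  simp [JAB, fromBlocks_multiply, ← fromBlocks_one, fromBlocks_neg, Jmat_mul_self]

/-- The single-mode squeezings with parameters `μ i`. -/
def squeeze {m : ℕ} (μ : Fin m → ℝ) : Matrix (Fin m ⊕ Fin m) (Fin m ⊕ Fin m) ℝ :=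
  fromBlocks (diagonal fun i => √(μ i)) 0 0 (diagonal fun i => (√(μ i))⁻¹)

theorem isSymplectic_squeeze {m : ℕ} {μ : Fin m → ℝ} (hμ : ∀ i, 0 < μ i) :
    IsSymplectic (Jmat m) (squeeze μ) := by
  have h : ∀ i, √(μ i) ≠ 0 := fun i => (Real.sqrt_pos.2 (hμ i)).ne'
  rw [IsSymplectic, squeeze, Jmat, fromBlocks_transpose, fromBlocks_multiply, fromBlocks_multiply]
  simp [h, ← diagonal_one, diagonal_neg]

theorem squeeze_mul_transpose {m : ℕ} {μ : Fin m → ℝ} (hμ : ∀ i, 0 < μ i) :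
    squeeze μ * (squeeze μ)ᵀ = fromBlocks (diagonal μ) 0 0 (diagonal fun i => (μ i)⁻¹) := by
  have h : ∀ i, √(μ i) * √(μ i) = μ i := fun i => Real.mul_self_sqrt (hμ i).le
  simp [squeeze, h, ← mul_inv]

theorem exists_symplectic_rotation_diagonalizing {nA nB : ℕ}
    {P : Matrix (ABIdx nA nB) (ABIdx nA nB) ℝ} (hP : P.PosSemidef)
    (hPJP : P * JAB nA nB * P = JAB nA nB) :
    ∃ U : Matrix (ABIdx nA nB) (ABIdx nA nB) ℝ,
      IsSymplectic (JAB nA nB) U ∧ Uᵀ * U = 1 ∧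
      ∃ (μA : Fin nA → ℝ) (μB : Fin nB → ℝ), (∀ i, 0 < μA i) ∧ (∀ i, 0 < μB i) ∧
        U * P * Uᵀ = fromBlocks (squeeze μA * (squeeze μA)ᵀ) 0 0
          (squeeze μB * (squeeze μB)ᵀ) := by
  obtain ⟨e, μ, hμ, he, heJ, heP, hePJ⟩ := exists_symplectic_eigenbasis (κ := Fin nA ⊕ Fin nB)
    (JAB_transpose nA nB) (JAB_mul_self nA nB) hP hPJP (by simp; ring)
  set J := JAB nA nB with hJ
  have hJadj : ∀ x y, (J *ᵥ x) ⬝ᵥ y = -(x ⬝ᵥ J *ᵥ y) := fun x y => by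
    rw [← vecMul_transpose, ← dotProduct_mulVec, JAB_transpose, neg_mulVec, dotProduct_neg]
  have hJJ : ∀ x, J *ᵥ (J *ᵥ x) = -x := fun x => by
    rw [mulVec_mulVec, JAB_mul_self, neg_mulVec, one_mulVec]
  let r : ABIdx nA nB → ABIdx nA nB → ℝ := Sum.elim
    (Sum.elim (fun i => e (.inl i)) (fun i => -(J *ᵥ e (.inl i))))
    (Sum.elim (fun i => e (.inr i)) (fun i => -(J *ᵥ e (.inr i))))
  have entry : ∀ M a b, (of r * M * (of r)ᵀ) a b = r a ⬝ᵥ M *ᵥ r b := fun M a b => by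
    rw [mul_assoc, mul_apply']
    rfl
  have hUU : of r * (of r)ᵀ = 1 := by
    ext a b
    change r a ⬝ᵥ r b = _
    rcases a with (a | a) | (a | a) <;> rcases b with (b | b) | (b | b) <;>
      simp [r, hJadj, hJJ, he, heJ, one_apply]
  have hUU' : (of r)ᵀ * of r = 1 := mul_eq_one_comm.1 hUU
  have hUJU : of r * J * (of r)ᵀ = J := by
    ext a b
    rw [entry]
    rcases a with (a | a) | (a | a) <;> rcases b with (b | b) | (b | b) <;>
      simp [r, hJadj, hJJ, he, heJ, mulVec_neg] <;> simp [hJ, JAB, Jmat, one_apply]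
  refine ⟨of r, ?_, hUU', fun i => μ (.inl i), fun i => μ (.inr i), 
    fun i => hμ _, fun i => hμ _, ?_⟩
  · rw [IsSymplectic]
    calc (of r)ᵀ * J * of r = ((of r)ᵀ * of r) * J * ((of r)ᵀ * of r) := by
          conv_lhs => rw [← hUJU]
          noncomm_ring
      _ = J := by rw [hUU', one_mul, mul_one]
  · rw [squeeze_mul_transpose fun i => hμ _, squeeze_mul_transpose fun i => hμ _]
    let m : ABIdx nA nB → ℝ := Sum.elim
      (Sum.elim (fun i => μ (.inl i)) (fun i => (μ (.inl i))⁻¹))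
      (Sum.elim (fun i => μ (.inr i)) (fun i => (μ (.inr i))⁻¹))
    have hPr : ∀ b, P *ᵥ r b = m b • r b := by
      rintro ((b | b) | (b | b)) <;> simp [r, m, heP, hePJ, mulVec_neg]
    have hrr : ∀ a b, r a ⬝ᵥ r b = (1 : Matrix (ABIdx nA nB) (ABIdx nA nB) ℝ) a b := fun a b => by
      rw [← hUU]
      rfl
    rw [fromBlocks_diagonal, fromBlocks_diagonal, fromBlocks_diagonal]
    ext a b
    rw [entry, hPr, dotProduct_smul, hrr, smul_eq_mul, one_apply, diagonal_apply, mul_ite, mul_one,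
      mul_zero]
    split_ifs with hab
    · rw [hab]
    · rfl

theorem re_dotProduct_uncertainty {ι : Type*} [Fintype ι] {J σ : Matrix ι ι ℝ} (hJt : Jᵀ = -J)
    {c : ℝ} (h : (cplx σ + (Complex.I * c) • cplx J).PosSemidef) (u v : ι → ℝ) :
    0 ≤ u ⬝ᵥ σ *ᵥ u + v ⬝ᵥ σ *ᵥ v - 2 * c * (u ⬝ᵥ J *ᵥ v) := by
  have h1 := (Complex.nonneg_iff.1 (h.dotProduct_mulVec_nonneg fun i => (u i : ℂ) + I * v i)).1
  have hJuv : v ⬝ᵥ J *ᵥ u = -(u ⬝ᵥ J *ᵥ v) := by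
    rw [dotProduct_comm, ← vecMul_transpose, ← dotProduct_mulVec, hJt, neg_mulVec, dotProduct_neg]
  refine h1.trans_eq ?_
  rw [show 2 * c * (u ⬝ᵥ J *ᵥ v) = c * (u ⬝ᵥ J *ᵥ v) - c * (v ⬝ᵥ J *ᵥ u) by rw [hJuv]; ring]
  simp only [dotProduct, mulVec, cplx, Finset.mul_sum, ← Finset.sum_add_distrib,
    ← Finset.sum_sub_distrib, re_sum]
  refine Finset.sum_congr rfl fun i _ => Finset.sum_congr rfl fun j _ => ?_
  simp
  ring

/-- Every Gaussian quantum covariance matrix `Σ` (a real symmetric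
positive definite matrix with `Σ + (iħ/2)J ≥ 0`) on a bipartite phase space
`ℝ^{2n} = ℝ^{2n_A} ⊕ ℝ^{2n_B}` can be brought, by a symplectic rotation `U`, to a matrix
`UΣUᵀ ≥ (ħ/2)(S_A S_Aᵀ ⊕ S_B S_Bᵀ)` which is separable in the Werner–Wolf sense. -/
theorem toeplitz_stmt0 (nA nB : ℕ) (hnA : 1 ≤ nA) (hnB : 1 ≤ nB)
    (hbar : ℝ) (hhbar : 0 < hbar)
    (Sg : Matrix (ABIdx nA nB) (ABIdx nA nB) ℝ)
    (hSg : Sg.IsSymm) (hpos : Sg.PosDef)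
    (hquant : (cplx Sg + (Complex.I * (hbar / 2)) • cplx (JAB nA nB)).PosSemidef) :
    ∃ U : Matrix (ABIdx nA nB) (ABIdx nA nB) ℝ,
      IsSymplectic (JAB nA nB) U ∧ Uᵀ * U = 1 ∧
      ∃ SA : Matrix (Fin nA ⊕ Fin nA) (Fin nA ⊕ Fin nA) ℝ,
      ∃ SB : Matrix (Fin nB ⊕ Fin nB) (Fin nB ⊕ Fin nB) ℝ,
        IsSymplectic (Jmat nA) SA ∧ IsSymplectic (Jmat nB) SB ∧
        (U * Sg * Uᵀ -
          (hbar / 2) • Matrix.fromBlocks (SA * SAᵀ) 0 0 (SB * SBᵀ)).PosSemidef := by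
  have hc : 0 < hbar / 2 := by positivity
  obtain ⟨P, hP, hPJP, hle⟩ := exists_symplectic_le (σ := (hbar / 2)⁻¹ • Sg)
    (JAB_transpose nA nB) (JAB_mul_self nA nB) (hpos.smul (inv_pos.2 hc)) fun u v => by
      have h1 := re_dotProduct_uncertainty (c := hbar / 2) (JAB_transpose nA nB)
        (by simpa using hquant) u v
      have h2 := mul_nonneg (inv_pos.2 hc).le h1
      refine h2.trans_eq ?_
      simp only [smul_mulVec, dotProduct_smul, smul_eq_mul]
      field_simp
  obtain ⟨U, hU, hUU, μA, μB, hA, hB, hdiag⟩ := exists_symplectic_rotation_diagonalizing hP hPJP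
  refine ⟨U, hU, hUU, squeeze μA, squeeze μB, isSymplectic_squeeze hA, isSymplectic_squeeze hB, ?_⟩
  rw [← hdiag]
  have h := (hle.mul_mul_conjTranspose_same U).smul hc.le
  convert h using 1
  rw [conjTranspose_eq_transpose_of_trivial, mul_sub, sub_mul, smul_sub, Matrix.mul_smul,
    Matrix.smul_mul, smul_smul, mul_inv_cancel₀ hc.ne', one_smul]
end
end

section
/- Let ħ > 0, let a ∈ L¹(ℝ²ⁿ), let φ be a Schwartz function on ℝⁿ, and let ψ, χ be Schwartz functions on ℝⁿ. Then ∫_{ℝ²ⁿ} a(z) (ψ | T̂(z)φ)_{L²} · conj((χ | T̂(z)φ)_{L²}) dz = (2πħ)ⁿ ∫_{ℝ²ⁿ} (a ∗ Wφ)(w) · W(ψ,χ)(w) dw, where ∗ is convolution on ℝ²ⁿ. (This expresses that the Toeplitz operator Op_φ(a) = ∫ a(z) Π̂_φ(z) dz, where Π̂_φ(z) is the orthogonal projection onto ℂ·T̂(z)φ, has Weyl symbol (2πħ)ⁿ (a ∗ Wφ).) -/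
open MeasureTheory Matrix Complex

noncomputable section

/-- The `ħ`-dependent cross-Wigner transform
`W(ψ,φ)(x,p) = (2πħ)^{-n} ∫ e^{-ip·y/ħ} ψ(x+y/2) conj(φ(x-y/2)) dy` on `ℝⁿ`. -/
def crossWigner (n : ℕ) (hbar : ℝ) (ψ φ : (Fin n → ℝ) → ℂ) (x p : Fin n → ℝ) : ℂ :=
  ((2 * Real.pi * hbar) ^ n)⁻¹ *
    ∫ y : Fin n → ℝ,
      Complex.exp (-(Complex.I * (((p ⬝ᵥ y) / hbar : ℝ) : ℂ))) *
        ψ (x + y / 2) * (starRingEnd ℂ) (φ (x - y / 2))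

/-- The Heisenberg displacement operator
`T̂(z₀)φ(x) = e^{(i/ħ)(p₀·x - p₀·x₀/2)} φ(x - x₀)`, `z₀ = (x₀,p₀)`. -/
def heisenberg (n : ℕ) (hbar : ℝ) (z₀ : (Fin n → ℝ) × (Fin n → ℝ))
    (φ : (Fin n → ℝ) → ℂ) (x : Fin n → ℝ) : ℂ :=
  Complex.exp (Complex.I * (((z₀.2 ⬝ᵥ x - z₀.2 ⬝ᵥ z₀.1 / 2) / hbar : ℝ) : ℂ)) *
    φ (x - z₀.1)

/-- The `ħ`-scaled Fourier integral `p ↦ ∫ e^{-ip·y/ħ} h(y) dy`. -/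
def hbarFourier (n : ℕ) (hbar : ℝ) (h : (Fin n → ℝ) → ℂ) (p : Fin n → ℝ) : ℂ :=
  ∫ y : Fin n → ℝ, Complex.exp (-(Complex.I * (((p ⬝ᵥ y) / hbar : ℝ) : ℂ))) * h y

/-- The integrand `ψ(x+y/2) conj(φ(x-y/2))` of the cross-Wigner transform. -/
def wignerKernel (n : ℕ) (ψ φ : (Fin n → ℝ) → ℂ) (x y : Fin n → ℝ) : ℂ :=
  ψ (x + y / 2) * (starRingEnd ℂ) (φ (x - y / 2))

section Wigner

variable {n : ℕ} {hbar : ℝ}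

lemma crossWigner_eq_hbarFourier (ψ φ : (Fin n → ℝ) → ℂ) (x p : Fin n → ℝ) :
    crossWigner n hbar ψ φ x p =
      ((2 * Real.pi * hbar) ^ n)⁻¹ * hbarFourier n hbar (wignerKernel n ψ φ x) p := by
  simp only [crossWigner, hbarFourier, wignerKernel, mul_assoc]

section Fourier

open scoped FourierTransform

/-- Parseval's identity for a Schwartz function against an integrable function. -/
lemma integral_fourier_mul_conj_fourier {V : Type*} [NormedAddCommGroup V]
    [InnerProductSpace ℝ V] [FiniteDimensional ℝ V] [MeasurableSpace V] [BorelSpace V]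
    (k : SchwartzMap V ℂ) {g : V → ℂ} (hg : Integrable g) :
    ∫ ξ, 𝓕 (k : V → ℂ) ξ * (starRingEnd ℂ) (𝓕 g ξ) = ∫ x, k x * (starRingEnd ℂ) (g x) := by
  have hk : Integrable (𝓕 (k : V → ℂ)) := by
    rw [← SchwartzMap.fourier_coe]
    exact (𝓕 k).integrable
  have key := VectorFourier.integral_sesq_fourierIntegral_eq_neg_flip (e := Real.fourierChar)
    (μ := (volume : Measure V)) (ν := (volume : Measure V)) (L := innerₗ V)
    (innerSL ℂ) Real.continuous_fourierChar continuous_inner hg hk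
  have hinv : VectorFourier.fourierIntegral Real.fourierChar (volume : Measure V)
      (-(innerₗ V).flip) (𝓕 (k : V → ℂ)) = k := by
    rw [flip_innerₗ]
    exact k.continuous.fourierInv_fourier_eq k.integrable hk
  rw [hinv] at key
  simp only [innerSL_apply_apply, RCLike.inner_apply] at key
  exact key

lemma hbarFourier_eq_fourier (h : (Fin n → ℝ) → ℂ) (p : Fin n → ℝ) :
    hbarFourier n hbar h p =
      𝓕 (fun v : EuclideanSpace ℝ (Fin n) ↦ h v.ofLp)
        (WithLp.toLp 2 ((2 * Real.pi * hbar)⁻¹ • p)) := by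
  rw [Real.fourier_eq', hbarFourier, ← (PiLp.volume_preserving_ofLp (Fin n)).integral_comp
    (MeasurableEquiv.toLp 2 (Fin n → ℝ)).symm.measurableEmbedding]
  congr 1 with v
  have : (inner ℝ v (WithLp.toLp 2 ((2 * Real.pi * hbar)⁻¹ • p)) : ℝ)
      = (2 * Real.pi * hbar)⁻¹ * (p ⬝ᵥ v.ofLp) := by
    simp [PiLp.inner_apply, dotProduct, Finset.mul_sum, mul_assoc]
  rw [this, smul_eq_mul]
  congr 2
  have : -2 * Real.pi * ((2 * Real.pi * hbar)⁻¹ * (p ⬝ᵥ v.ofLp)) = -((p ⬝ᵥ v.ofLp) / hbar) := by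
    rw [mul_inv, mul_inv]
    field_simp
  rw [this]
  push_cast
  ring

/-- A Schwartz function on `ℝⁿ`, viewed on Euclidean space. -/
def SchwartzMap.onEuclidean (h : SchwartzMap (Fin n → ℝ) ℂ) :
    SchwartzMap (EuclideanSpace ℝ (Fin n)) ℂ :=
  SchwartzMap.compCLMOfContinuousLinearEquiv ℂ (EuclideanSpace.equiv (Fin n) ℝ) h

lemma integral_comp_toLp_smul (hh : 0 < hbar) {F : Type*} [NormedAddCommGroup F] [NormedSpace ℝ F]
    (f : EuclideanSpace ℝ (Fin n) → F) :
    ∫ p : Fin n → ℝ, f (WithLp.toLp 2 ((2 * Real.pi * hbar)⁻¹ • p)) =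
      (2 * Real.pi * hbar) ^ n • ∫ v, f v := by
  rw [Measure.integral_comp_smul volume (fun p : Fin n → ℝ ↦ f (WithLp.toLp 2 p)),
    (PiLp.volume_preserving_toLp (Fin n)).integral_comp
      (MeasurableEquiv.toLp 2 (Fin n → ℝ)).measurableEmbedding]
  congr 1
  rw [Module.finrank_fin_fun, inv_pow, inv_inv, abs_of_pos (by positivity)]

lemma integrable_hbarFourier (hh : 0 < hbar) (h : SchwartzMap (Fin n → ℝ) ℂ) :
    Integrable (hbarFourier n hbar h) := by
  have h1 : Integrable fun v : Fin n → ℝ ↦ 𝓕 h.onEuclidean (WithLp.toLp 2 v) :=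
    (PiLp.volume_preserving_toLp (Fin n)).integrable_comp_of_integrable
      (𝓕 h.onEuclidean).integrable
  refine (h1.comp_smul (R := (2 * Real.pi * hbar)⁻¹) (by positivity)).congr (ae_of_all _ fun p ↦ ?_)
  simp only [hbarFourier_eq_fourier]
  rfl

/-- Parseval's identity for the `ħ`-scaled Fourier integral. -/
lemma integral_hbarFourier_mul_conj (hh : 0 < hbar) (h : SchwartzMap (Fin n → ℝ) ℂ)
    {g : (Fin n → ℝ) → ℂ} (hg : Integrable g) :
    ∫ p, hbarFourier n hbar h p * (starRingEnd ℂ) (hbarFourier n hbar g p) =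
      (2 * Real.pi * hbar) ^ n * ∫ y, h y * (starRingEnd ℂ) (g y) := by
  have hg' : Integrable fun v : EuclideanSpace ℝ (Fin n) ↦ g v.ofLp :=
    (PiLp.volume_preserving_ofLp (Fin n)).integrable_comp_of_integrable hg
  have key := integral_fourier_mul_conj_fourier h.onEuclidean hg'
  simp only [hbarFourier_eq_fourier]
  rw [integral_comp_toLp_smul hh fun v ↦ 𝓕 (fun v : EuclideanSpace ℝ (Fin n) ↦ h v.ofLp) v *
    (starRingEnd ℂ) (𝓕 (fun v : EuclideanSpace ℝ (Fin n) ↦ g v.ofLp) v)]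
  rw [← (PiLp.volume_preserving_ofLp (Fin n)).integral_comp
    (MeasurableEquiv.toLp 2 (Fin n → ℝ)).symm.measurableEmbedding, Complex.real_smul]
  push_cast
  exact congrArg _ key

end Fourier

/-- The change of variables `(x, y) ↦ (x + y/2, x - y/2)` preserves Lebesgue measure. -/
lemma measurePreserving_add_half_sub_half :
    MeasurePreserving (fun q : (Fin n → ℝ) × (Fin n → ℝ) ↦ (q.1 + q.2 / 2, q.1 - q.2 / 2)) := by
  have h1 : MeasurePreserving
      (fun q : (Fin n → ℝ) × (Fin n → ℝ) ↦ (q.1, q.2 + q.1 / 2)) (volume.prod volume)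
      (volume.prod volume) :=
    (MeasurePreserving.id volume).skew_product (g := fun y x ↦ x + y / 2)
      (by simp only [div_eq_mul_inv]; fun_prop)
      (ae_of_all _ fun y ↦ (measurePreserving_add_right volume (y / 2)).map_eq)
  have h2 : MeasurePreserving
      (fun q : (Fin n → ℝ) × (Fin n → ℝ) ↦ (q.1, q.1 - q.2)) (volume.prod volume)
      (volume.prod volume) :=
    (MeasurePreserving.id volume).skew_product (g := fun u y ↦ u - y) (by fun_prop)
      (ae_of_all _ fun u ↦ (Measure.measurePreserving_sub_left volume u).map_eq)
  have h3 := h2.comp ((Measure.measurePreserving_swap (μ := (volume : Measure (Fin n → ℝ)))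
    (ν := (volume : Measure (Fin n → ℝ)))).comp
      (h1.comp (Measure.measurePreserving_swap (μ := (volume : Measure (Fin n → ℝ)))
        (ν := (volume : Measure (Fin n → ℝ))))))
  convert! h3 using 1
  funext q
  simp only [Function.comp_apply, Prod.swap_prod_mk, Prod.fst_swap, Prod.snd_swap]
  ext i <;> simp
  ring

lemma integrable_mul_conj_prod {u v : (Fin n → ℝ) → ℂ} (hu : Integrable u) (hv : Integrable v) :
    Integrable fun q : (Fin n → ℝ) × (Fin n → ℝ) ↦ u q.1 * (starRingEnd ℂ) (v q.2) :=
  hu.mul_prod (Complex.conjCLE.integrable_comp_iff.2 hv)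

lemma integrable_wignerKernel {u v : (Fin n → ℝ) → ℂ} (hu : Integrable u) (hv : Integrable v) :
    Integrable fun q : (Fin n → ℝ) × (Fin n → ℝ) ↦ wignerKernel n u v q.1 q.2 :=
  measurePreserving_add_half_sub_half.integrable_comp_of_integrable (integrable_mul_conj_prod hu hv)

lemma integral_wignerKernel {u v : (Fin n → ℝ) → ℂ} (hu : Integrable u) (hv : Integrable v) :
    ∫ x, ∫ y, wignerKernel n u v x y = (∫ x, u x) * (starRingEnd ℂ) (∫ x, v x) := by
  have hT := measurePreserving_add_half_sub_half (n := n)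
  rw [integral_integral (integrable_wignerKernel hu hv), ← integral_conj, ← integral_prod_mul]
  have := integral_map hT.measurable.aemeasurable
    (hT.map_eq.symm ▸ (integrable_mul_conj_prod hu hv).aestronglyMeasurable)
  rw [hT.map_eq] at this
  exact this.symm

lemma wignerKernel_mul_conj (ψ χ f g : (Fin n → ℝ) → ℂ) (x y : Fin n → ℝ) :
    wignerKernel n ψ χ x y * (starRingEnd ℂ) (wignerKernel n f g x y) =
      wignerKernel n (fun x ↦ ψ x * (starRingEnd ℂ) (f x))
        (fun x ↦ χ x * (starRingEnd ℂ) (g x)) x y := by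
  simp only [wignerKernel, map_mul, Complex.conj_conj]
  ring

/-- For fixed `x`, the kernel `y ↦ ψ(x+y/2) conj(χ(x-y/2))` is a Schwartz function. -/
lemma exists_schwartzMap_eq_wignerKernel (ψ χ : SchwartzMap (Fin n → ℝ) ℂ) (x : Fin n → ℝ) :
    ∃ h : SchwartzMap (Fin n → ℝ) ℂ, (h : (Fin n → ℝ) → ℂ) = wignerKernel n ψ χ x := by
  let L : (Fin n → ℝ) →L[ℝ] (Fin n → ℝ) := (2⁻¹ : ℝ) • ContinuousLinearMap.id ℝ _
  have hL (y : Fin n → ℝ) : L y = y / 2 := by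
    ext i
    simp [L, div_eq_inv_mul]
  have hadd : Function.HasTemperateGrowth fun y : Fin n → ℝ ↦ x + y / 2 := by
    simp only [← hL]
    exact (Function.HasTemperateGrowth.const x).add L.hasTemperateGrowth
  have hsub : Function.HasTemperateGrowth fun y : Fin n → ℝ ↦ x - y / 2 := by
    simp only [← hL]
    exact (Function.HasTemperateGrowth.const x).sub L.hasTemperateGrowth
  have hanti : AntilipschitzWith 2 fun y : Fin n → ℝ ↦ x + y / 2 := by
    refine AntilipschitzWith.of_le_mul_dist fun y z ↦ ?_
    rw [dist_add_left, ← hL, ← hL, dist_eq_norm, dist_eq_norm, ← map_sub]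
    simp [L, norm_smul]
  have hconj : Function.HasTemperateGrowth fun y : Fin n → ℝ ↦
      (starRingEnd ℂ) (χ (x - y / 2)) :=
    (Complex.conjCLE.hasTemperateGrowth.comp χ.hasTemperateGrowth).comp hsub
  refine ⟨SchwartzMap.bilinLeftCLM (ContinuousLinearMap.mul ℂ ℂ) hconj
    (SchwartzMap.compCLMOfAntilipschitz ℂ hadd hanti ψ), ?_⟩
  funext y
  simp [SchwartzMap.bilinLeftCLM_apply, wignerKernel]

lemma stronglyMeasurable_crossWigner {f g : (Fin n → ℝ) → ℂ} (hf : Continuous f)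
    (hg : Continuous g) :
    StronglyMeasurable fun w : (Fin n → ℝ) × (Fin n → ℝ) ↦ crossWigner n hbar f g w.1 w.2 := by
  refine StronglyMeasurable.const_mul (StronglyMeasurable.integral_prod_right
    (f := fun (w : (Fin n → ℝ) × (Fin n → ℝ)) (y : Fin n → ℝ) ↦
      Complex.exp (-(Complex.I * (((w.2 ⬝ᵥ y) / hbar : ℝ) : ℂ))) *
        f (w.1 + y / 2) * (starRingEnd ℂ) (g (w.1 - y / 2))) ?_) _
  refine Continuous.stronglyMeasurable ?_
  simp only [Function.uncurry_def, dotProduct, div_eq_mul_inv]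
  fun_prop

lemma integral_crossWigner_mul_conj_right (hh : 0 < hbar) (ψ χ : SchwartzMap (Fin n → ℝ) ℂ)
    {f g : (Fin n → ℝ) → ℂ} {x : Fin n → ℝ} (hfg : Integrable (wignerKernel n f g x)) :
    ∫ p, crossWigner n hbar ψ χ x p * (starRingEnd ℂ) (crossWigner n hbar f g x p) =
      ((2 * Real.pi * hbar) ^ n)⁻¹ *
        ∫ y, wignerKernel n ψ χ x y * (starRingEnd ℂ) (wignerKernel n f g x y) := by
  obtain ⟨h, hh'⟩ := exists_schwartzMap_eq_wignerKernel ψ χ x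
  have key := integral_hbarFourier_mul_conj hh h hfg
  rw [hh'] at key
  simp only [crossWigner_eq_hbarFourier, map_mul, Complex.conj_ofReal]
  simp_rw [mul_mul_mul_comm]
  rw [integral_const_mul, key]
  push_cast
  field_simp

lemma integrable_norm_sq_crossWigner_right (hh : 0 < hbar) (ψ χ : SchwartzMap (Fin n → ℝ) ℂ)
    (x : Fin n → ℝ) : Integrable fun p ↦ ‖crossWigner n hbar ψ χ x p‖ ^ 2 := by
  obtain ⟨h, hh'⟩ := exists_schwartzMap_eq_wignerKernel ψ χ x
  have hi : Integrable (crossWigner n hbar ψ χ x) := by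
    simp only [funext (crossWigner_eq_hbarFourier (hbar := hbar) ψ χ x), ← hh']
    exact (integrable_hbarFourier hh h).const_mul _
  have hb (p : Fin n → ℝ) : ‖crossWigner n hbar ψ χ x p‖ ≤
      ‖((((2 * Real.pi * hbar) ^ n)⁻¹ : ℝ) : ℂ)‖ * ∫ y, ‖h y‖ := by
    rw [crossWigner_eq_hbarFourier, norm_mul, ← hh']
    gcongr
    refine (norm_integral_le_integral_norm _).trans_eq (integral_congr_ae (ae_of_all _ fun y ↦ ?_))
    simp [Complex.norm_exp]
  simp only [pow_two]
  exact hi.norm.bdd_mul hi.aestronglyMeasurable.norm (ae_of_all _ fun p ↦ by simpa using hb p)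

lemma integrable_mul_conj (ψ : SchwartzMap (Fin n → ℝ) ℂ) {f : (Fin n → ℝ) → ℂ}
    (hf : Integrable f) : Integrable fun x ↦ ψ x * (starRingEnd ℂ) (f x) :=
  (Complex.conjCLE.integrable_comp_iff.2 hf).bdd_mul ψ.continuous.aestronglyMeasurable
    (ae_of_all _ fun x ↦ ψ.toBoundedContinuousFunction.norm_coe_le_norm x)

/-- The cross-Wigner transform of two Schwartz functions is square integrable. -/
lemma integrable_norm_sq_crossWigner (hh : 0 < hbar) (ψ χ : SchwartzMap (Fin n → ℝ) ℂ) :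
    Integrable fun w : (Fin n → ℝ) × (Fin n → ℝ) ↦ ‖crossWigner n hbar ψ χ w.1 w.2‖ ^ 2 := by
  refine (integrable_prod_iff ((stronglyMeasurable_crossWigner ψ.continuous
    χ.continuous).norm.pow 2).aestronglyMeasurable).2
    ⟨ae_of_all _ (integrable_norm_sq_crossWigner_right hh ψ χ), ?_⟩
  have h1 := ((integrable_wignerKernel (integrable_mul_conj ψ ψ.integrable)
    (integrable_mul_conj χ χ.integrable)).integral_prod_left.const_mul
      ((((2 * Real.pi * hbar) ^ n)⁻¹ : ℝ) : ℂ)).norm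
  refine h1.congr (ae_of_all _ fun x ↦ ?_)
  obtain ⟨h, hh'⟩ := exists_schwartzMap_eq_wignerKernel ψ χ x
  have key := integral_crossWigner_mul_conj_right hh ψ χ (hh' ▸ h.integrable)
  simp only [wignerKernel_mul_conj] at key
  change ‖_ * ∫ y, wignerKernel n _ _ x y‖ = ∫ p, ‖‖crossWigner n hbar ψ χ x p‖ ^ 2‖
  rw [← key]
  simp only [Complex.mul_conj, Complex.normSq_eq_norm_sq]
  rw [integral_complex_ofReal, Complex.norm_real, Real.norm_of_nonneg (by positivity)]
  simp

/-- A product of two square integrable functions is integrable. -/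
lemma integrable_mul_of_norm_sq {α : Type*} [MeasurableSpace α] {μ : Measure α} {F G : α → ℂ}
    (hF : AEStronglyMeasurable F μ) (hG : AEStronglyMeasurable G μ)
    (hF2 : Integrable (fun w ↦ ‖F w‖ ^ 2) μ) (hG2 : Integrable (fun w ↦ ‖G w‖ ^ 2) μ) :
    Integrable (fun w ↦ F w * G w) μ :=
  MemLp.integrable_mul ((memLp_two_iff_integrable_sq_norm hF).2 hF2)
    ((memLp_two_iff_integrable_sq_norm hG).2 hG2)

/-- Moyal's identity `∫ W(ψ,χ) conj W(f,g) = (2πħ)^{-n} (ψ|f) conj (χ|g)`. -/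
lemma integral_crossWigner_mul_conj (hh : 0 < hbar) (ψ χ : SchwartzMap (Fin n → ℝ) ℂ)
    {f g : (Fin n → ℝ) → ℂ} (hf : Integrable f) (hg : Integrable g)
    (hint : Integrable fun w : (Fin n → ℝ) × (Fin n → ℝ) ↦ crossWigner n hbar ψ χ w.1 w.2 *
      (starRingEnd ℂ) (crossWigner n hbar f g w.1 w.2)) :
    ∫ w : (Fin n → ℝ) × (Fin n → ℝ), crossWigner n hbar ψ χ w.1 w.2 *
        (starRingEnd ℂ) (crossWigner n hbar f g w.1 w.2) =
      ((2 * Real.pi * hbar) ^ n)⁻¹ * ((∫ x, ψ x * (starRingEnd ℂ) (f x)) *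
        (starRingEnd ℂ) (∫ x, χ x * (starRingEnd ℂ) (g x))) := by
  rw [← integral_wignerKernel (integrable_mul_conj ψ hf) (integrable_mul_conj χ hg),
    ← integral_const_mul, Measure.volume_eq_prod, integral_prod _ hint]
  refine integral_congr_ae ?_
  filter_upwards [(integrable_wignerKernel hf hg).prod_right_ae] with x hx
  simp only [← wignerKernel_mul_conj]
  exact integral_crossWigner_mul_conj_right hh ψ χ hx

lemma conj_crossWigner_self (φ : (Fin n → ℝ) → ℂ) (x p : Fin n → ℝ) :
    (starRingEnd ℂ) (crossWigner n hbar φ φ x p) = crossWigner n hbar φ φ x p := by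
  simp only [crossWigner, map_mul, Complex.conj_ofReal, ← integral_conj]
  congr 1
  rw [← integral_neg_eq_self]
  refine integral_congr_ae (ae_of_all _ fun y ↦ ?_)
  simp only [← Complex.exp_conj, map_neg, map_mul, Complex.conj_I, Complex.conj_ofReal,
    Complex.conj_conj, neg_div, sub_neg_eq_add, ← sub_eq_add_neg, dotProduct_neg]
  push_cast
  ring_nf

lemma crossWigner_heisenberg (φ : (Fin n → ℝ) → ℂ)
    (z w : (Fin n → ℝ) × (Fin n → ℝ)) :
    crossWigner n hbar (heisenberg n hbar z φ) (heisenberg n hbar z φ) w.1 w.2 =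
      crossWigner n hbar φ φ (w - z).1 (w - z).2 := by
  simp only [crossWigner]
  congr 2 with y
  have e1 : w.1 + y / 2 - z.1 = (w - z).1 + y / 2 := by simp only [Prod.fst_sub]; abel
  have e2 : w.1 - y / 2 - z.1 = (w - z).1 - y / 2 := by simp only [Prod.fst_sub]; abel
  have hy : y / 2 = (2⁻¹ : ℝ) • y := by
    ext i
    simp [div_eq_inv_mul]
  simp only [heisenberg, e1, e2, map_mul, ← Complex.exp_conj, Complex.conj_I, Complex.conj_ofReal]
  rw [mul_mul_mul_comm, mul_assoc, mul_assoc, mul_left_comm, ← mul_assoc, ← mul_assoc, ← mul_assoc,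
    ← Complex.exp_add, ← Complex.exp_add, mul_assoc, mul_assoc]
  congr 2
  simp only [hy, dotProduct_add, dotProduct_sub, dotProduct_smul, Prod.snd_sub, sub_dotProduct,
    smul_eq_mul]
  push_cast
  field_simp
  ring

lemma integrable_heisenberg {φ : (Fin n → ℝ) → ℂ} (hφ : Integrable φ)
    (z : (Fin n → ℝ) × (Fin n → ℝ)) : Integrable (heisenberg n hbar z φ) := by
  refine (hφ.comp_sub_right z.1).bdd_mul (c := 1) ?_ (ae_of_all _ fun x ↦ ?_)
  · refine Continuous.aestronglyMeasurable ?_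
    simp only [dotProduct]
    fun_prop
  · rw [mul_comm, Complex.norm_exp_ofReal_mul_I]

end Wigner

/-- The Toeplitz operator `Op_φ(a) = ∫ a(z) Π̂_φ(z) dz` with window `φ`
and symbol `a ∈ L¹(ℝ²ⁿ)` is the Weyl operator with symbol `(2πħ)ⁿ (a ∗ Wφ)`; in terms of
matrix coefficients between Schwartz functions `ψ, χ`:
`∫ a(z)(ψ|T̂(z)φ) conj((χ|T̂(z)φ)) dz = (2πħ)ⁿ ∫ (a ∗ Wφ)(w) W(ψ,χ)(w) dw`. -/
theorem toeplitz_stmt11 (n : ℕ) (hbar : ℝ) (hhbar : 0 < hbar)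
    (a : ((Fin n → ℝ) × (Fin n → ℝ)) → ℂ) (ha : Integrable a)
    (φ ψ χ : SchwartzMap (Fin n → ℝ) ℂ) :
    ∫ z : (Fin n → ℝ) × (Fin n → ℝ),
        a z * (∫ x : Fin n → ℝ, ψ x * (starRingEnd ℂ) (heisenberg n hbar z φ x)) *
          (starRingEnd ℂ)
            (∫ x : Fin n → ℝ, χ x * (starRingEnd ℂ) (heisenberg n hbar z φ x))
      = ((2 * Real.pi * hbar) ^ n : ℝ) *
          ∫ w : (Fin n → ℝ) × (Fin n → ℝ),
            (∫ z : (Fin n → ℝ) × (Fin n → ℝ), a (w - z) * crossWigner n hbar φ φ z.1 z.2) *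
              crossWigner n hbar ψ χ w.1 w.2 := by
  have : (volume : Measure ((Fin n → ℝ) × (Fin n → ℝ))).IsAddHaarMeasure :=
    Measure.prod.instIsAddHaarMeasure volume volume
  have : (volume : Measure ((Fin n → ℝ) × (Fin n → ℝ))).IsNegInvariant :=
    ⟨((Measure.measurePreserving_neg volume).prod (Measure.measurePreserving_neg volume)).map_eq⟩
  have hc : ((2 * Real.pi * hbar : ℂ) ^ n) ≠ 0 :=
    pow_ne_zero _ (by exact_mod_cast (by positivity : 2 * Real.pi * hbar ≠ 0))
  set F : (Fin n → ℝ) × (Fin n → ℝ) → ℂ := fun w ↦ crossWigner n hbar ψ χ w.1 w.2 with hF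
  set G : (Fin n → ℝ) × (Fin n → ℝ) → ℂ := fun w ↦ crossWigner n hbar φ φ w.1 w.2 with hG
  have hFm : StronglyMeasurable F := stronglyMeasurable_crossWigner ψ.continuous χ.continuous
  have hGm : StronglyMeasurable G := stronglyMeasurable_crossWigner φ.continuous φ.continuous
  have hF2 : Integrable fun w ↦ ‖F w‖ ^ 2 := integrable_norm_sq_crossWigner hhbar ψ χ
  have hG2 : Integrable fun w ↦ ‖G w‖ ^ 2 := integrable_norm_sq_crossWigner hhbar φ φ
  have hGF (z : (Fin n → ℝ) × (Fin n → ℝ)) : Integrable fun w ↦ F w * G (w - z) :=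
    integrable_mul_of_norm_sq hFm.aestronglyMeasurable
      (hGm.comp_measurable (measurable_sub_const z)).aestronglyMeasurable hF2
      (hG2.comp_sub_right z)
  have moyal (z : (Fin n → ℝ) × (Fin n → ℝ)) :
      (∫ x, ψ x * (starRingEnd ℂ) (heisenberg n hbar z φ x)) *
          (starRingEnd ℂ) (∫ x, χ x * (starRingEnd ℂ) (heisenberg n hbar z φ x)) =
        (2 * Real.pi * hbar) ^ n * ∫ w, F w * G (w - z) := by
    have hcov (w : (Fin n → ℝ) × (Fin n → ℝ)) : (starRingEnd ℂ) (crossWigner n hbar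
        (heisenberg n hbar z φ) (heisenberg n hbar z φ) w.1 w.2) = G (w - z) := by
      rw [crossWigner_heisenberg, conj_crossWigner_self]
    have hT := integrable_heisenberg (hbar := hbar) φ.integrable z
    have key := integral_crossWigner_mul_conj hhbar ψ χ hT hT (by simpa only [hcov] using hGF z)
    simp only [hcov] at key
    rw [key]
    push_cast
    rw [mul_inv_cancel_left₀ hc]
  have hint : Integrable (Function.uncurry fun w z : (Fin n → ℝ) × (Fin n → ℝ) ↦
      a z * G (w - z) * F w) (volume.prod volume) := by
    have hm : AEStronglyMeasurable (Function.uncurry fun w z : (Fin n → ℝ) × (Fin n → ℝ) ↦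
        a z * G (w - z) * F w) (volume.prod volume) :=
      (ha.aestronglyMeasurable.comp_snd.mul
        (hGm.comp_measurable measurable_sub).aestronglyMeasurable).mul
        hFm.aestronglyMeasurable.comp_fst
    have h1 := hF2.mul_prod ha.norm
    have h2 := ha.norm.convolution_integrand (ContinuousLinearMap.mul ℝ ℝ) hG2
    refine (h1.add h2).mono hm (ae_of_all _ fun q ↦ ?_)
    simp only [Function.uncurry, norm_mul, Pi.add_apply, ContinuousLinearMap.mul_apply']
    rw [Real.norm_of_nonneg (by positivity)]
    nlinarith [norm_nonneg (a q.2), mul_nonneg (norm_nonneg (a q.2))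
      (add_nonneg (sq_nonneg (‖F q.1‖ - ‖G (q.1 - q.2)‖))
        (add_nonneg (sq_nonneg ‖F q.1‖) (sq_nonneg ‖G (q.1 - q.2)‖)))]
  have hconv (w : (Fin n → ℝ) × (Fin n → ℝ)) :
      (∫ z, a (w - z) * G z) * F w = ∫ z, a z * G (w - z) * F w := by
    rw [integral_mul_const, ← integral_sub_left_eq_self _ _ w]
    simp only [sub_sub_cancel]
  calc
    _ = ∫ z, ((2 * Real.pi * hbar) ^ n : ℂ) * ∫ w, a z * G (w - z) * F w := by
      refine integral_congr_ae (ae_of_all _ fun z ↦ ?_)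
      simp only
      rw [mul_assoc, moyal z, mul_left_comm, ← integral_const_mul (a z)]
      simp only [mul_assoc, mul_comm (F _)]
    _ = _ := by
      have hswap : (∫ z, ∫ w, a z * G (w - z) * F w) = ∫ w, (∫ z, a (w - z) * G z) * F w := by
        simp only [hconv]
        exact (integral_integral_swap hint).symm
      rw [integral_const_mul, hswap]
      push_cast
      rfl
end
end

section
/- Let ħ > 0, let m < −2n and 0 < δ ≤ 1, and let a ∈ C^∞(ℝ²ⁿ, ℂ) be a symbol in the Shubin class Γ^m_δ(ℝ²ⁿ), i.e. for every multi-index α there exists C_α ≥ 0 with |∂^α_z a(z)| ≤ C_α (1+|z|)^{m−δ|α|} for all z ∈ ℝ²ⁿ. Define the kernel K(x,y) = (2πħ)^{-n} ∫_{ℝⁿ} e^{−i p·(x−y)/ħ} a((x+y)/2, p) dp. Then the integral operator Âψ(x) = ∫ K(x,y)ψ(y) dy is a trace class operator on L²(ℝⁿ), and for every orthonormal (Hilbert) basis (e_j) of L²(ℝⁿ) the family j ↦ (Â e_j | e_j)_{L²} is summable with sum (2πħ)^{-n} ∫_{ℝ²ⁿ} a(z) dz. -/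
open MeasureTheory Matrix Complex

noncomputable section

/-- The phase space `ℝ²ⁿ = ℝⁿ × ℝⁿ`, `z = (x,p)`. -/
abbrev Phase (n : ℕ) := (Fin n → ℝ) × (Fin n → ℝ)

/-- The Weyl kernel `K(x,y) = (2πħ)^{-n} ∫ e^{-ip·(x-y)/ħ} a((x+y)/2, p) dp` of the Weyl
operator `Op_W(a)`. -/
def weylKernel (n : ℕ) (hbar : ℝ) (a : Phase n → ℂ) (x y : Fin n → ℝ) : ℂ :=
  ((2 * Real.pi * hbar) ^ n)⁻¹ *
    ∫ p : Fin n → ℝ,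
      Complex.exp (-(Complex.I * (((p ⬝ᵥ (x - y)) / hbar : ℝ) : ℂ))) * a ((x + y) / 2, p)

section HilbertSchmidt

variable {X Ω : Type*} [MeasurableSpace X] [MeasurableSpace Ω] {ν : Measure X} {μ : Measure Ω}

theorem integrable_norm_sq_of_memLp {f : X → ℂ} (hf : MemLp f 2 ν) :
    Integrable (fun x => ‖f x‖ ^ 2) ν :=
  (memLp_two_iff_integrable_sq_norm hf.1).1 hf

theorem norm_integral_mul_sq_le {f g : X → ℂ} (hf : MemLp f 2 ν) (hg : MemLp g 2 ν) :
    ‖∫ x, f x * g x ∂ν‖ ^ 2 ≤ (∫ x, ‖f x‖ ^ 2 ∂ν) * ∫ x, ‖g x‖ ^ 2 ∂ν := by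
  have h1 : ‖∫ x, f x * g x ∂ν‖ ≤ ∫ x, ‖f x‖ * ‖g x‖ ∂ν := by
    refine (norm_integral_le_integral_norm _).trans_eq ?_
    simp only [norm_mul]
  have h2 := integral_mul_norm_le_Lp_mul_Lq (μ := ν) (f := f) (g := g)
    Real.HolderConjugate.two_two (by simpa using hf) (by simpa using hg)
  have hF : 0 ≤ ∫ x, ‖f x‖ ^ 2 ∂ν := integral_nonneg fun x => by positivity
  have hG : 0 ≤ ∫ x, ‖g x‖ ^ 2 ∂ν := integral_nonneg fun x => by positivity
  simp only [Real.rpow_two, ← Real.sqrt_eq_rpow] at h2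
  calc ‖∫ x, f x * g x ∂ν‖ ^ 2
      ≤ (√(∫ x, ‖f x‖ ^ 2 ∂ν) * √(∫ x, ‖g x‖ ^ 2 ∂ν)) ^ 2 := by
        gcongr; exact h1.trans h2
    _ = _ := by rw [mul_pow, Real.sq_sqrt hF, Real.sq_sqrt hG]

theorem integral_norm_sq_eq_norm_sq (f : Lp ℂ 2 ν) : ∫ x, ‖f x‖ ^ 2 ∂ν = ‖f‖ ^ 2 := by
  have h := L2.inner_def (𝕜 := ℂ) f f
  rw [inner_self_eq_norm_sq_to_K] at h
  have h2 : ∀ x, inner ℂ (f x) (f x) = ((‖f x‖ ^ 2 : ℝ) : ℂ) := fun x => by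
    rw [inner_self_eq_norm_sq_to_K]; simp
  simp only [h2] at h
  rw [integral_complex_ofReal] at h
  exact Complex.ofReal_injective (h.symm.trans (by push_cast; rfl))

/-- A square integrable kernel defines a bounded operator on `L²`. -/
theorem exists_clm_of_integrable_sq_kernel [SigmaFinite ν] {K : X → X → ℂ}
    (hKm : StronglyMeasurable (Function.uncurry K))
    (hK : Integrable (fun p : X × X => ‖K p.1 p.2‖ ^ 2) (ν.prod ν)) :
    ∃ A : Lp ℂ 2 ν →L[ℂ] Lp ℂ 2 ν,
      ∀ f : Lp ℂ 2 ν, (A f : X → ℂ) =ᵐ[ν] fun x => ∫ y, K x y * f y ∂ν := by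
  have hrow : ∀ᵐ x ∂ν, MemLp (K x) 2 ν := by
    filter_upwards [hK.prod_right_ae] with x hx
    exact (memLp_two_iff_integrable_sq_norm
      (hKm.comp_measurable measurable_prodMk_left).aestronglyMeasurable).2 hx
  have hinteg : Integrable (fun x => ∫ y, ‖K x y‖ ^ 2 ∂ν) ν := hK.integral_prod_left
  have hmeas : ∀ f : Lp ℂ 2 ν, StronglyMeasurable fun x => ∫ y, K x y * f y ∂ν := fun f =>
    StronglyMeasurable.integral_prod_right (f := fun x y => K x y * f y)
      (hKm.mul ((Lp.stronglyMeasurable f).comp_measurable measurable_snd))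
  have hbd : ∀ f : Lp ℂ 2 ν, ∀ᵐ x ∂ν,
      ‖∫ y, K x y * f y ∂ν‖ ^ 2 ≤ (∫ y, ‖K x y‖ ^ 2 ∂ν) * ‖f‖ ^ 2 := fun f => by
    filter_upwards [hrow] with x hx
    rw [← integral_norm_sq_eq_norm_sq]
    exact norm_integral_mul_sq_le hx (Lp.memLp f)
  have hmem : ∀ f : Lp ℂ 2 ν, MemLp (fun x => ∫ y, K x y * f y ∂ν) 2 ν := fun f => by
    refine (memLp_two_iff_integrable_sq_norm (hmeas f).aestronglyMeasurable).2 ?_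
    refine (hinteg.mul_const (‖f‖ ^ 2)).mono' ((hmeas f).norm.pow 2).aestronglyMeasurable ?_
    filter_upwards [hbd f] with x hx
    rwa [Real.norm_of_nonneg (by positivity)]
  let L : Lp ℂ 2 ν →ₗ[ℂ] Lp ℂ 2 ν :=
    { toFun := fun f => (hmem f).toLp
      map_add' := fun f g => by
        rw [← MemLp.toLp_add]
        refine (MemLp.toLp_eq_toLp_iff _ _).2 ?_
        filter_upwards [hrow] with x hx
        refine Eq.trans (integral_congr_ae ?_) (integral_add (hx.integrable_mul (Lp.memLp f))
          (hx.integrable_mul (Lp.memLp g)))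
        filter_upwards [Lp.coeFn_add f g] with y hy
        simp only [hy, Pi.add_apply, mul_add]
      map_smul' := fun c f => by
        rw [← MemLp.toLp_const_smul]
        refine (MemLp.toLp_eq_toLp_iff _ _).2 ?_
        refine Filter.Eventually.of_forall fun x => ?_
        simp only [Pi.smul_apply, RingHom.id_apply]
        rw [← integral_smul]
        refine integral_congr_ae ?_
        filter_upwards [Lp.coeFn_smul c f] with y hy
        rw [hy, Pi.smul_apply, smul_eq_mul, smul_eq_mul, mul_left_comm] }
  have hL : ∀ f : Lp ℂ 2 ν, (L f : X → ℂ) =ᵐ[ν] fun x => ∫ y, K x y * f y ∂ν := fun f =>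
    (hmem f).coeFn_toLp
  have hKnn : 0 ≤ ∫ x, ∫ y, ‖K x y‖ ^ 2 ∂ν ∂ν :=
    integral_nonneg fun x => integral_nonneg fun y => by positivity
  refine ⟨L.mkContinuous (√(∫ x, ∫ y, ‖K x y‖ ^ 2 ∂ν ∂ν)) fun f => ?_, hL⟩
  refine le_of_sq_le_sq ?_ (by positivity)
  rw [mul_pow, Real.sq_sqrt hKnn, ← integral_norm_sq_eq_norm_sq, ← integral_mul_const]
  refine integral_mono_ae (integrable_norm_sq_of_memLp (Lp.memLp _)) (hinteg.mul_const _) ?_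
  filter_upwards [hbd f, hL f] with x hx hx'
  rw [hx']
  exact hx

theorem HilbertBasis.countable_of_separableSpace {ι E : Type*} [NormedAddCommGroup E]
    [InnerProductSpace ℂ E] [TopologicalSpace.SeparableSpace E] (e : HilbertBasis ι ℂ E) :
    Countable ι := by
  have hdist : ∀ i j : ι, i ≠ j → 1 ≤ dist (e i) (e j) := fun i j hij => by
    have hin : inner ℂ (e i) (e j) = 0 := e.orthonormal.2 hij
    have h := @norm_sub_sq ℂ E _ _ _ (e i) (e j)
    rw [hin, e.orthonormal.1 i, e.orthonormal.1 j] at h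
    simp only [map_zero] at h
    rw [dist_eq_norm]
    nlinarith [norm_nonneg (e i - e j)]
  have : (Set.univ : Set ι).Countable := by
    refine Set.PairwiseDisjoint.countable_of_isOpen (s := fun i => Metric.ball (e i) (1 / 2))
      ?_ (fun i _ => Metric.isOpen_ball) (fun i _ => Metric.nonempty_ball.2 (by norm_num))
    intro i _ j _ hij
    exact Metric.ball_disjoint_ball (by have := hdist i j hij; linarith)
  exact Set.countable_univ_iff.1 this


theorem memLp_of_integrable_sq_prod [SFinite ν] [SFinite μ] {U : Ω → X → ℂ}
    (hUm : StronglyMeasurable (Function.uncurry U))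
    (hU : Integrable (fun p : Ω × X => ‖U p.1 p.2‖ ^ 2) (μ.prod ν)) :
    ∀ᵐ ω ∂μ, MemLp (U ω) 2 ν := by
  filter_upwards [hU.prod_right_ae] with ω hω
  exact (memLp_two_iff_integrable_sq_norm
    (hUm.comp_measurable measurable_prodMk_left).aestronglyMeasurable).2 hω

theorem integrable_kernel_mul_mul_conj [SigmaFinite ν] [SigmaFinite μ] {U V : Ω → X → ℂ}
    (hUm : StronglyMeasurable (Function.uncurry U)) (hVm : StronglyMeasurable (Function.uncurry V))
    (hU : Integrable (fun p : Ω × X => ‖U p.1 p.2‖ ^ 2) (μ.prod ν))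
    (hV : Integrable (fun p : Ω × X => ‖V p.1 p.2‖ ^ 2) (μ.prod ν)) (g : Lp ℂ 2 ν) :
    Integrable (fun q : Ω × (X × X) =>
      (U q.1 q.2.1 * (starRingEnd ℂ) (g q.2.1)) * (V q.1 q.2.2 * g q.2.2))
      (μ.prod (ν.prod ν)) := by
  have hg := Lp.stronglyMeasurable g
  have hgL := Lp.memLp g
  have hgc : MemLp (fun x => (starRingEnd ℂ) (g x)) 2 ν := hgL.star
  have hm : StronglyMeasurable (fun q : Ω × (X × X) =>
      (U q.1 q.2.1 * (starRingEnd ℂ) (g q.2.1)) * (V q.1 q.2.2 * g q.2.2)) := by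
    refine StronglyMeasurable.mul (StronglyMeasurable.mul ?_ ?_) (StronglyMeasurable.mul ?_ ?_)
    · exact hUm.comp_measurable (g := fun q : Ω × (X × X) => (q.1, q.2.1)) (by fun_prop)
    · exact (hg.comp_measurable (g := fun q : Ω × (X × X) => q.2.1) (by fun_prop)).star
    · exact hVm.comp_measurable (g := fun q : Ω × (X × X) => (q.1, q.2.2)) (by fun_prop)
    · exact hg.comp_measurable (g := fun q : Ω × (X × X) => q.2.2) (by fun_prop)
  have hUr := memLp_of_integrable_sq_prod hUm hU
  have hVr := memLp_of_integrable_sq_prod hVm hV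
  refine (integrable_prod_iff hm.aestronglyMeasurable).2 ⟨?_, ?_⟩
  · filter_upwards [hUr, hVr] with ω h1 h2
    exact (h1.integrable_mul hgc).mul_prod (h2.integrable_mul hgL)
  · have hb := (hU.integral_prod_left.add hV.integral_prod_left).mul_const (‖g‖ ^ 2 / 2)
    refine hb.mono' hm.norm.integral_prod_right.aestronglyMeasurable ?_
    filter_upwards [hUr, hVr] with ω h1 h2
    rw [Real.norm_of_nonneg (integral_nonneg fun _ => norm_nonneg _)]
    simp only [norm_mul (_ * _) (_ * _)]
    rw [integral_prod_mul (fun x => ‖U ω x * (starRingEnd ℂ) (g x)‖) (fun y => ‖V ω y * g y‖)]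
    have e1 := norm_integral_mul_sq_le (f := fun x => ((‖U ω x‖ : ℝ) : ℂ))
      (g := fun x => ((‖g x‖ : ℝ) : ℂ)) h1.norm.ofReal hgL.norm.ofReal
    have e2 := norm_integral_mul_sq_le (f := fun x => ((‖V ω x‖ : ℝ) : ℂ))
      (g := fun x => ((‖g x‖ : ℝ) : ℂ)) h2.norm.ofReal hgL.norm.ofReal
    simp only [← ofReal_mul, integral_complex_ofReal, norm_real,
      integral_norm_sq_eq_norm_sq, Real.norm_eq_abs, sq_abs] at e1 e2
    simp only [norm_mul, RCLike.norm_conj, Pi.add_apply]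
    nlinarith [sq_nonneg ((∫ x, ‖U ω x‖ * ‖g x‖ ∂ν) - ∫ x, ‖V ω x‖ * ‖g x‖ ∂ν)]

/-- An operator whose kernel is a composition of two square integrable kernels has, in every
Hilbert basis, a trace equal to the integral of its kernel over the diagonal. -/
theorem exists_clm_hasSum_trace_of_factorization [SigmaFinite ν] [SigmaFinite μ]
    [TopologicalSpace.SeparableSpace (Lp ℂ 2 ν)] {U V : Ω → X → ℂ}
    (hUm : StronglyMeasurable (Function.uncurry U)) (hVm : StronglyMeasurable (Function.uncurry V))
    (hU : Integrable (fun p : Ω × X => ‖U p.1 p.2‖ ^ 2) (μ.prod ν))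
    (hV : Integrable (fun p : Ω × X => ‖V p.1 p.2‖ ^ 2) (μ.prod ν)) {K : X → X → ℂ}
    (hK : ∀ x y, K x y = ∫ ω, U ω x * V ω y ∂μ) :
    ∃ A : Lp ℂ 2 ν →L[ℂ] Lp ℂ 2 ν,
      (∀ f : Lp ℂ 2 ν, (A f : X → ℂ) =ᵐ[ν] fun x => ∫ y, K x y * f y ∂ν) ∧
      ∀ (ι : Type) (e : HilbertBasis ι ℂ (Lp ℂ 2 ν)),
        HasSum (fun j : ι => ∫ x, (A (e j) : X → ℂ) x * (starRingEnd ℂ) ((e j : X → ℂ) x) ∂ν)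
          (∫ x, K x x ∂ν) := by
  have hKm : StronglyMeasurable (Function.uncurry K) := by
    have : Function.uncurry K = fun p : X × X => ∫ ω, U ω p.1 * V ω p.2 ∂μ := by
      ext p; exact hK p.1 p.2
    rw [this]
    refine StronglyMeasurable.integral_prod_right (f := fun (p : X × X) ω => U ω p.1 * V ω p.2) ?_
    exact (hUm.comp_measurable (g := fun q : (X × X) × Ω => (q.2, q.1.1)) (by fun_prop)).mul
      (hVm.comp_measurable (g := fun q : (X × X) × Ω => (q.2, q.1.2)) (by fun_prop))
  have hUc : ∀ᵐ x ∂ν, MemLp (fun ω => U ω x) 2 μ :=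
    memLp_of_integrable_sq_prod (U := fun x ω => U ω x)
      (hUm.comp_measurable measurable_swap) hU.swap
  have hVc : ∀ᵐ x ∂ν, MemLp (fun ω => V ω x) 2 μ :=
    memLp_of_integrable_sq_prod (U := fun x ω => V ω x)
      (hVm.comp_measurable measurable_swap) hV.swap
  have hKsq : Integrable (fun p : X × X => ‖K p.1 p.2‖ ^ 2) (ν.prod ν) := by
    refine (hU.swap.integral_prod_left.mul_prod hV.swap.integral_prod_left).mono'
      (hKm.norm.pow 2).aestronglyMeasurable ?_
    filter_upwards [Measure.quasiMeasurePreserving_fst.ae hUc,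
      Measure.quasiMeasurePreserving_snd.ae hVc] with p h1 h2
    rw [Real.norm_of_nonneg (by positivity), hK]
    exact norm_integral_mul_sq_le h1 h2
  obtain ⟨A, hA⟩ := exists_clm_of_integrable_sq_kernel hKm hKsq
  refine ⟨A, hA, fun ι e => ?_⟩
  have := e.countable_of_separableSpace
  have hUr := memLp_of_integrable_sq_prod hUm hU
  have hVr := memLp_of_integrable_sq_prod hVm hV
  have hterm : ∀ g : Lp ℂ 2 ν, ∫ x, (A g : X → ℂ) x * (starRingEnd ℂ) (g x) ∂ν =
      ∫ ω, (∫ x, U ω x * (starRingEnd ℂ) (g x) ∂ν) * (∫ y, V ω y * g y ∂ν) ∂μ := fun g => by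
    have hF := integrable_kernel_mul_mul_conj hUm hVm hU hV g
    have h1 : ∀ p : X × X, ∫ ω, (U ω p.1 * (starRingEnd ℂ) (g p.1)) * (V ω p.2 * g p.2) ∂μ =
        (K p.1 p.2 * g p.2) * (starRingEnd ℂ) (g p.1) := fun p => by
      rw [hK, ← integral_mul_const, ← integral_mul_const]
      refine integral_congr_ae (.of_forall fun ω => ?_)
      ring
    calc ∫ x, (A g : X → ℂ) x * (starRingEnd ℂ) (g x) ∂ν
        = ∫ x, (∫ y, (K x y * g y) * (starRingEnd ℂ) (g x) ∂ν) ∂ν := by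
          refine integral_congr_ae ?_
          filter_upwards [hA g] with x hx
          rw [hx, integral_mul_const]
      _ = ∫ p : X × X, (K p.1 p.2 * g p.2) * (starRingEnd ℂ) (g p.1) ∂(ν.prod ν) := by
          have := hF.integral_prod_right
          simp only [h1] at this
          rw [integral_prod _ this]
      _ = ∫ p : X × X, ∫ ω, (U ω p.1 * (starRingEnd ℂ) (g p.1)) * (V ω p.2 * g p.2) ∂μ
            ∂(ν.prod ν) := by simp only [h1]
      _ = ∫ ω, ∫ p : X × X, (U ω p.1 * (starRingEnd ℂ) (g p.1)) * (V ω p.2 * g p.2)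
            ∂(ν.prod ν) ∂μ := (integral_integral_swap hF).symm
      _ = _ := by
          refine integral_congr_ae (.of_forall fun ω => ?_)
          exact integral_prod_mul (fun x => U ω x * (starRingEnd ℂ) (g x)) (fun y => V ω y * g y)
  have hdiag : ∫ x, K x x ∂ν = ∫ ω, ∫ x, U ω x * V ω x ∂ν ∂μ := by
    simp only [hK]
    refine (integral_integral_swap (f := fun ω x => U ω x * V ω x) ?_).symm
    have h1 := (memLp_two_iff_integrable_sq_norm hUm.aestronglyMeasurable).2 hU
    have h2 := (memLp_two_iff_integrable_sq_norm hVm.aestronglyMeasurable).2 hV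
    exact h1.integrable_mul h2
  simp only [hterm]
  rw [hdiag]
  -- the two integrals over `X` are inner products with elements of the basis
  have hinU : ∀ ω (h : MemLp (U ω) 2 ν) (g : Lp ℂ 2 ν),
      inner ℂ g h.toLp = ∫ x, U ω x * (starRingEnd ℂ) (g x) ∂ν := fun ω h g => by
    rw [L2.inner_def]
    refine integral_congr_ae ?_
    filter_upwards [h.coeFn_toLp] with x hx
    rw [hx]; rfl
  have hinV : ∀ ω (h : MemLp (star (V ω)) 2 ν) (g : Lp ℂ 2 ν),
      inner ℂ h.toLp g = ∫ x, V ω x * g x ∂ν := fun ω h g => by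
    rw [L2.inner_def]
    refine integral_congr_ae ?_
    filter_upwards [h.coeFn_toLp] with x hx
    rw [hx]
    simp [mul_comm]
  have hsq : ∀ x y : Lp ℂ 2 ν, HasSum (fun j => (‖inner ℂ (e j) x‖ ^ 2 + ‖inner ℂ y (e j)‖ ^ 2) / 2)
      ((‖x‖ ^ 2 + ‖y‖ ^ 2) / 2) := fun x y => by
    have hp : ∀ x : Lp ℂ 2 ν, HasSum (fun j => ‖inner ℂ (e j) x‖ ^ 2) (‖x‖ ^ 2) := fun x => by
      have := e.hasSum_inner_mul_inner x x
      have h2 : ∀ j, inner ℂ x (e j) * inner ℂ (e j) x = ((‖inner ℂ (e j) x‖ ^ 2 : ℝ) : ℂ) :=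
        fun j => by
          rw [← inner_conj_symm x (e j), ← Complex.normSq_eq_conj_mul_self,
            Complex.normSq_eq_norm_sq]
      simp only [h2, inner_self_eq_norm_sq_to_K] at this
      refine Complex.hasSum_ofReal.1 ?_
      rw [ofReal_pow]
      exact this
    have := (hp x).add (hp y)
    simp only [norm_inner_symm y]
    exact this.div_const 2
  have hnU : ∀ ω (h : MemLp (U ω) 2 ν), ‖h.toLp‖ ^ 2 = ∫ x, ‖U ω x‖ ^ 2 ∂ν := fun ω h => by
    rw [← integral_norm_sq_eq_norm_sq]
    refine integral_congr_ae ?_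
    filter_upwards [h.coeFn_toLp] with x hx
    rw [hx]
  have hnV : ∀ ω (h : MemLp (star (V ω)) 2 ν), ‖h.toLp‖ ^ 2 = ∫ x, ‖V ω x‖ ^ 2 ∂ν :=
    fun ω h => by
      rw [← integral_norm_sq_eq_norm_sq]
      refine integral_congr_ae ?_
      filter_upwards [h.coeFn_toLp] with x hx
      rw [hx, Pi.star_apply, norm_star]
  have hall : ∀ᵐ ω ∂μ, HasSum (fun j => (‖∫ x, U ω x * (starRingEnd ℂ) (e j x) ∂ν‖ ^ 2 +
      ‖∫ y, V ω y * e j y ∂ν‖ ^ 2) / 2)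
      (((∫ x, ‖U ω x‖ ^ 2 ∂ν) + ∫ x, ‖V ω x‖ ^ 2 ∂ν) / 2) := by
    filter_upwards [hUr, hVr] with ω h1 h2
    have := hsq h1.toLp (MemLp.toLp _ h2.star)
    simpa only [hinU, hinV, hnU, hnV] using this
  refine hasSum_integral_of_dominated_convergence
    (fun j ω => (‖∫ x, U ω x * (starRingEnd ℂ) (e j x) ∂ν‖ ^ 2 +
      ‖∫ y, V ω y * e j y ∂ν‖ ^ 2) / 2) (fun j => ?_) (fun j => ?_) ?_ ?_ ?_
  · have hg := Lp.stronglyMeasurable (e j)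
    refine StronglyMeasurable.aestronglyMeasurable (StronglyMeasurable.mul ?_ ?_)
    · exact StronglyMeasurable.integral_prod_right
        (f := fun ω x => U ω x * (starRingEnd ℂ) (e j x))
        (hUm.mul (hg.comp_measurable measurable_snd).star)
    · exact StronglyMeasurable.integral_prod_right (f := fun ω x => V ω x * e j x)
        (hVm.mul (hg.comp_measurable measurable_snd))
  · refine .of_forall fun ω => ?_
    rw [norm_mul]
    nlinarith [sq_nonneg (‖∫ x, U ω x * (starRingEnd ℂ) (e j x) ∂ν‖ - ‖∫ y, V ω y * e j y ∂ν‖)]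
  · filter_upwards [hall] with ω h using h.summable
  · refine ((hU.integral_prod_left.add hV.integral_prod_left).div_const 2).congr ?_
    filter_upwards [hall] with ω h
    rw [h.tsum_eq]; rfl
  · filter_upwards [hUr, hVr] with ω h1 h2
    have := e.hasSum_inner_mul_inner (MemLp.toLp _ h2.star) h1.toLp
    rw [hinV ω h2.star] at this
    simp only [hinU, hinV] at this
    have hlim : ∫ x, V ω x * (h1.toLp : X → ℂ) x ∂ν = ∫ x, U ω x * V ω x ∂ν := by
      refine integral_congr_ae ?_
      filter_upwards [h1.coeFn_toLp] with x hx
      rw [hx, mul_comm]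
    rw [← hlim]
    exact this.congr_fun fun j => mul_comm _ _

end HilbertSchmidt

section SymbolClass

variable {E : Type*} [NormedAddCommGroup E] [NormedSpace ℝ E]

/-- Smooth functions all of whose derivatives are `O((1 + ‖z‖) ^ m)`. -/
def IsSymbol (m : ℝ) (f : E → ℂ) : Prop :=
  ContDiff ℝ (⊤ : ℕ∞) f ∧ ∀ k : ℕ, ∃ C : ℝ, ∀ z, ‖iteratedFDeriv ℝ k f z‖ ≤ C * (1 + ‖z‖) ^ m

/-- The first order operator `1 + ∂_v`. -/
def oneAddDeriv (v : E) (f : E → ℂ) (z : E) : ℂ := f z + fderiv ℝ f z v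

theorem IsSymbol.oneAddDeriv {m : ℝ} {f : E → ℂ} (hf : IsSymbol m f) (v : E) :
    IsSymbol m (oneAddDeriv v f) := by
  have hd : ContDiff ℝ (⊤ : ℕ∞) (fderiv ℝ f) := hf.1.fderiv_right (by simp)
  have hdv : ContDiff ℝ (⊤ : ℕ∞) (fun z => fderiv ℝ f z v) := hd.clm_apply contDiff_const
  refine ⟨hf.1.add hdv, fun k => ?_⟩
  obtain ⟨C, hC⟩ := hf.2 k
  obtain ⟨D, hD⟩ := hf.2 (k + 1)
  have hk : (k : WithTop ℕ∞) ≤ ((⊤ : ℕ∞) : WithTop ℕ∞) := by exact_mod_cast le_top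
  refine ⟨C + ‖ContinuousLinearMap.apply ℝ ℂ v‖ * D, fun z => ?_⟩
  have e : iteratedFDeriv ℝ k (_root_.oneAddDeriv v f) z =
      iteratedFDeriv ℝ k f z + iteratedFDeriv ℝ k (fun z => fderiv ℝ f z v) z :=
    iteratedFDeriv_add_apply (hf.1.of_le hk).contDiffAt (hdv.of_le hk).contDiffAt
  have h2 : ‖iteratedFDeriv ℝ k (fun z => fderiv ℝ f z v) z‖ ≤
      ‖ContinuousLinearMap.apply ℝ ℂ v‖ * ‖iteratedFDeriv ℝ k (fderiv ℝ f) z‖ :=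
    (ContinuousLinearMap.apply ℝ ℂ v).norm_iteratedFDeriv_comp_left
      hd.contDiffAt hk
  rw [norm_iteratedFDeriv_fderiv] at h2
  rw [e, add_mul, mul_assoc]
  refine (norm_add_le _ _).trans (add_le_add (hC z) (h2.trans ?_))
  gcongr
  exact hD z

theorem IsSymbol.exists_norm_le {m : ℝ} {f : E → ℂ} (hf : IsSymbol m f) :
    ∃ C : ℝ, 0 ≤ C ∧ ∀ z, ‖f z‖ ≤ C * (1 + ‖z‖) ^ m := by
  obtain ⟨C, hC⟩ := hf.2 0
  refine ⟨C, ?_, fun z => by simpa using hC z⟩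
  have := (norm_nonneg _).trans (hC 0)
  simpa using this

theorem IsSymbol.exists_bound {m : ℝ} (hm : m ≤ 0) {f : E → ℂ} (hf : IsSymbol m f) :
    ∃ C : ℝ, 0 ≤ C ∧ ∀ z, ‖f z‖ ≤ C := by
  obtain ⟨C, hC0, hC⟩ := hf.exists_norm_le
  refine ⟨C, hC0, fun z => (hC z).trans (mul_le_of_le_one_right hC0 ?_)⟩
  exact Real.rpow_le_one_of_one_le_of_nonpos (by linarith [norm_nonneg z]) hm

theorem IsSymbol.continuous {m : ℝ} {f : E → ℂ} (hf : IsSymbol m f) : Continuous f :=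
  hf.1.continuous

theorem IsSymbol.differentiable {m : ℝ} {f : E → ℂ} (hf : IsSymbol m f) : Differentiable ℝ f :=
  hf.1.differentiable (by simp)

/-- The density of the Gamma distribution with shape `3`, and its derivative. -/
def gammaDensity (t : ℝ) : ℝ := if 0 < t then t ^ 2 / 2 * Real.exp (-t) else 0

def gammaDensityDeriv (t : ℝ) : ℝ := if 0 < t then (t - t ^ 2 / 2) * Real.exp (-t) else 0

theorem hasDerivAt_sq_mul_exp_neg (t : ℝ) :
    HasDerivAt (fun t : ℝ => t ^ 2 / 2 * Real.exp (-t)) ((t - t ^ 2 / 2) * Real.exp (-t)) t := by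
  have h := (((hasDerivAt_id t).pow 2).div_const 2).mul (hasDerivAt_id t).neg.exp
  refine h.congr_deriv ?_
  simp only [id, Nat.cast_ofNat, Pi.neg_apply, Pi.pow_apply]
  ring

theorem hasDerivAt_gammaDensity (t : ℝ) :
    HasDerivAt gammaDensity (gammaDensityDeriv t) t := by
  rw [← hasDerivWithinAt_univ, ← Set.Iic_union_Ici (a := (0 : ℝ))]
  have hl : ∀ s ∈ Set.Iic (0 : ℝ), gammaDensity s = 0 := fun s hs => by
    simp [gammaDensity, not_lt.2 (show s ≤ 0 from hs)]
  have hr : ∀ s ∈ Set.Ici (0 : ℝ), gammaDensity s = s ^ 2 / 2 * Real.exp (-s) := fun s hs => by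
    rcases eq_or_lt_of_le (show 0 ≤ s from hs) with h | h
    · simp [gammaDensity, ← h]
    · simp [gammaDensity, h]
  refine HasDerivWithinAt.union ?_ ?_
  · rcases le_or_gt t 0 with h | h
    · have : gammaDensityDeriv t = 0 := by simp [gammaDensityDeriv, not_lt.2 h]
      rw [this]
      exact (hasDerivWithinAt_const t _ (0 : ℝ)).congr hl (hl t h)
    · refine HasFDerivWithinAt.of_notMem_closure ?_
      rw [closure_Iic]; simpa using h
  · rcases lt_or_ge t 0 with h | h
    · refine HasFDerivWithinAt.of_notMem_closure ?_
      rw [closure_Ici]; simpa using h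
    · have : gammaDensityDeriv t = (t - t ^ 2 / 2) * Real.exp (-t) := by
        rcases eq_or_lt_of_le h with h | h
        · simp [gammaDensityDeriv, ← h]
        · simp [gammaDensityDeriv, h]
      rw [this]
      exact (hasDerivAt_sq_mul_exp_neg t).hasDerivWithinAt.congr hr (hr t h)

theorem pow_mul_exp_neg_le (k : ℕ) {t : ℝ} (ht : 0 ≤ t) :
    t ^ k * Real.exp (-t) ≤ k.factorial := by
  have h := Real.pow_div_factorial_le_exp t ht k
  rw [div_le_iff₀ (by positivity)] at h
  rw [Real.exp_neg, ← div_eq_mul_inv, div_le_iff₀ (Real.exp_pos t)]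
  linarith

theorem exists_gammaDensity_le : ∃ C : ℝ, 0 ≤ C ∧ ∀ t,
    |gammaDensity t| ≤ C * ((1 + t ^ 2) ^ 2)⁻¹ ∧
      |gammaDensityDeriv t| ≤ C * ((1 + t ^ 2) ^ 2)⁻¹ := by
  refine ⟨10000, by norm_num, fun t => ?_⟩
  have hp : (0 : ℝ) < (1 + t ^ 2) ^ 2 := by positivity
  rw [← div_eq_mul_inv, le_div_iff₀ hp, le_div_iff₀ hp]
  rcases le_or_gt t 0 with h | h
  · simp [gammaDensity, gammaDensityDeriv, not_lt.2 h]
  have h1 := pow_mul_exp_neg_le 1 h.le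
  have h2 := pow_mul_exp_neg_le 2 h.le
  have h3 := pow_mul_exp_neg_le 3 h.le
  have h4 := pow_mul_exp_neg_le 4 h.le
  have h5 := pow_mul_exp_neg_le 5 h.le
  have h6 := pow_mul_exp_neg_le 6 h.le
  norm_num [Nat.factorial] at h1 h2 h3 h4 h5 h6
  have e := Real.exp_pos (-t)
  simp only [gammaDensity, gammaDensityDeriv, h, if_true, abs_mul, abs_of_pos e]
  have a1 : |t ^ 2 / 2| = t ^ 2 / 2 := abs_of_nonneg (by positivity)
  have a2 : |t - t ^ 2 / 2| ≤ t + t ^ 2 / 2 :=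
    (abs_sub _ _).trans (by rw [abs_of_pos h, a1])
  rw [a1]
  constructor
  · nlinarith
  · calc |t - t ^ 2 / 2| * Real.exp (-t) * (1 + t ^ 2) ^ 2
        ≤ (t + t ^ 2 / 2) * Real.exp (-t) * (1 + t ^ 2) ^ 2 := by gcongr
      _ ≤ 10000 := by nlinarith

theorem continuous_gammaDensity : Continuous gammaDensity :=
  continuous_iff_continuousAt.2 fun t => (hasDerivAt_gammaDensity t).continuousAt

theorem measurable_gammaDensityDeriv : Measurable gammaDensityDeriv := by
  unfold gammaDensityDeriv
  exact Measurable.ite measurableSet_Ioi (by fun_prop) measurable_const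

theorem integrable_gammaDensity : Integrable gammaDensity := by
  obtain ⟨C, hC0, hC⟩ := exists_gammaDensity_le
  refine (integrable_inv_one_add_sq.const_mul C).mono'
    continuous_gammaDensity.aestronglyMeasurable (.of_forall fun t => ?_)
  refine (hC t).1.trans ?_
  gcongr
  nlinarith [sq_nonneg t]

theorem integral_gammaDensity_smul {m : ℝ} (hm : m ≤ 0) {f : E → ℂ} (hf : IsSymbol m f) (v z : E) :
    ∫ s : ℝ, (gammaDensity s : ℂ) *
      oneAddDeriv v (oneAddDeriv v (oneAddDeriv v f)) (z - s • v) = f z := by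
  set f₁ := oneAddDeriv v f with hf₁
  set f₂ := oneAddDeriv v f₁ with hf₂
  set f₃ := oneAddDeriv v f₂ with hf₃
  have S₁ : IsSymbol m f₁ := hf.oneAddDeriv v
  have S₂ : IsSymbol m f₂ := S₁.oneAddDeriv v
  have S₃ : IsSymbol m f₃ := S₂.oneAddDeriv v
  have hline : ∀ g : E → ℂ, Differentiable ℝ g → ∀ s : ℝ,
      HasDerivAt (fun s : ℝ => (Real.exp (-s) : ℂ) * g (z - s • v))
        (-((Real.exp (-s) : ℂ) * oneAddDeriv v g (z - s • v))) s := fun g hg s => by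
    have h1 : HasDerivAt (fun s : ℝ => z - s • v) (-v) s := by
      simpa using ((hasDerivAt_id s).smul_const v).const_sub z
    have h2 := (hg (z - s • v)).hasFDerivAt.comp_hasDerivAt s h1
    have h3 := (hasDerivAt_id s).neg.exp.ofReal_comp
    have h4 := h3.mul h2
    refine h4.congr_deriv ?_
    simp only [oneAddDeriv, map_neg, id, Pi.neg_apply, Function.comp_apply]
    push_cast
    ring
  have hΦ : ∀ s : ℝ, HasDerivAt (fun s : ℝ => -((s ^ 2 / 2 : ℂ) *
        ((Real.exp (-s) : ℂ) * f₂ (z - s • v)) + s * ((Real.exp (-s) : ℂ) * f₁ (z - s • v)) +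
        (Real.exp (-s) : ℂ) * f (z - s • v)))
      (((s ^ 2 / 2 * Real.exp (-s) : ℝ) : ℂ) * f₃ (z - s • v)) s := fun s => by
    have i1 : HasDerivAt (fun s : ℝ => (s : ℂ)) 1 s := (hasDerivAt_id s).ofReal_comp
    have i2 : HasDerivAt (fun s : ℝ => (s ^ 2 / 2 : ℂ)) s s := by
      refine ((i1.pow 2).div_const 2).congr_deriv ?_
      simp
    have h := (((i2.mul (hline f₂ S₂.differentiable s)).add
      (i1.mul (hline f₁ S₁.differentiable s))).add (hline f hf.differentiable s)).neg
    refine h.congr_deriv ?_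
    rw [← hf₁, ← hf₂, ← hf₃]
    push_cast
    ring
  have hlim : Filter.Tendsto (fun s : ℝ => -((s ^ 2 / 2 : ℂ) *
        ((Real.exp (-s) : ℂ) * f₂ (z - s • v)) + s * ((Real.exp (-s) : ℂ) * f₁ (z - s • v)) +
        (Real.exp (-s) : ℂ) * f (z - s • v))) Filter.atTop (nhds 0) := by
    have key : ∀ (k : ℕ) (g : E → ℂ), IsSymbol m g → Filter.Tendsto
        (fun s : ℝ => ((s ^ k * Real.exp (-s) : ℝ) : ℂ) * g (z - s • v)) Filter.atTop (nhds 0) :=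
      fun k g hg => by
        obtain ⟨C, hC0, hC⟩ := hg.exists_bound hm
        have h := (Real.tendsto_pow_mul_exp_neg_atTop_nhds_zero k).norm.mul_const C
        rw [norm_zero, zero_mul] at h
        refine squeeze_zero_norm (fun s => ?_) h
        rw [norm_mul, norm_real]
        gcongr
        exact hC _
    have h := ((((key 2 f₂ S₂).const_mul (1 / 2)).add (key 1 f₁ S₁)).add (key 0 f hf)).neg
    simp only [mul_zero, add_zero, neg_zero] at h
    refine h.congr fun s => ?_
    push_cast
    ring
  have hinteg : Integrable fun s : ℝ => (gammaDensity s : ℂ) * f₃ (z - s • v) := by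
    obtain ⟨C, hC0, hC⟩ := S₃.exists_bound hm
    refine integrable_gammaDensity.ofReal.mul_bdd
      (S₃.continuous.comp (by fun_prop)).aestronglyMeasurable (.of_forall fun s => hC _)
  have hγ : ∀ s ∈ Set.Ioi (0 : ℝ), (gammaDensity s : ℂ) * f₃ (z - s • v) =
      ((s ^ 2 / 2 * Real.exp (-s) : ℝ) : ℂ) * f₃ (z - s • v) := fun s hs => by
    have : 0 < s := hs
    simp only [gammaDensity, this, if_true]
  have h := integral_Ioi_of_hasDerivAt_of_tendsto' (a := 0) (fun s _ => hΦ s)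
    (hinteg.integrableOn.congr_fun hγ measurableSet_Ioi) hlim
  rw [← setIntegral_congr_fun measurableSet_Ioi hγ, setIntegral_eq_integral_of_forall_compl_eq_zero]
    at h
  · rw [h]; simp
  · intro s hs
    have : ¬ 0 < s := hs
    simp [gammaDensity, this]

/-- A symbol is a superposition of translates of another symbol. -/
theorem IsSymbol.exists_eq_integral_gammaDensity {m : ℝ} (hm : m ≤ 0) (n : ℕ) :
    ∀ {f : E → ℂ}, IsSymbol m f → ∀ v : Fin n → E, ∃ b : E → ℂ, IsSymbol m b ∧
      ∀ z, f z = ∫ s : Fin n → ℝ, (∏ j, (gammaDensity (s j) : ℂ)) * b (z - ∑ j, s j • v j) := by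
  induction n with
  | zero =>
    intro f hf v
    refine ⟨f, hf, fun z => ?_⟩
    simp [volume_pi, Measure.real]
  | succ n ih =>
    intro f hf v
    obtain ⟨b, hb, hfb⟩ := ih (((hf.oneAddDeriv (v 0)).oneAddDeriv (v 0)).oneAddDeriv (v 0))
      (fun j => v j.succ)
    refine ⟨b, hb, fun z => ?_⟩
    obtain ⟨C, hC0, hC⟩ := hb.exists_bound hm
    set e : ℝ × (Fin n → ℝ) ≃ᵐ (Fin (n + 1) → ℝ) :=
      (MeasurableEquiv.piFinSuccAbove (fun _ => ℝ) 0).symm with he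
    have hem : MeasurePreserving e :=
      (volume_preserving_piFinSuccAbove (fun _ : Fin (n + 1) => ℝ) 0).symm _
    have hinteg : Integrable fun s : Fin (n + 1) → ℝ =>
        (∏ j, (gammaDensity (s j) : ℂ)) * b (z - ∑ j, s j • v j) := by
      refine (Integrable.fintype_prod (f := fun (_ : Fin (n + 1)) t => (gammaDensity t : ℂ))
        fun _ => integrable_gammaDensity.ofReal).mul_bdd
        (hb.continuous.comp (by fun_prop)).aestronglyMeasurable (.of_forall fun s => hC _)
    have hinteg' : Integrable (fun x => (∏ j, (gammaDensity (e x j) : ℂ)) *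
        b (z - ∑ j, e x j • v j)) (volume.prod volume) := hem.integrable_comp_of_integrable hinteg
    rw [← hem.integral_comp', Measure.volume_eq_prod, integral_prod _ hinteg',
      ← integral_gammaDensity_smul hm hf (v 0) z]
    refine integral_congr_ae (.of_forall fun t => ?_)
    simp only [hfb]
    rw [← integral_const_mul]
    refine integral_congr_ae (.of_forall fun s => ?_)
    have e0 : e (t, s) 0 = t := rfl
    have es : ∀ j : Fin n, e (t, s) j.succ = s j := fun j => rfl
    simp only [Fin.prod_univ_succ, Fin.sum_univ_succ, e0, es, sub_sub, mul_assoc]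

end SymbolClass


section OscillatoryIntegral

variable {n : ℕ}

theorem IsSymbol.integrable_mk_left {m : ℝ} (hm : m < -n) {f : Phase n → ℂ} (hf : IsSymbol m f)
    (q : Fin n → ℝ) : Integrable fun p => f (q, p) := by
  obtain ⟨C, hC0, hC⟩ := hf.exists_norm_le
  have hm0 : m ≤ 0 := by linarith [(Nat.cast_nonneg n : (0 : ℝ) ≤ n)]
  have h : Integrable fun p : Fin n → ℝ => (1 + ‖p‖) ^ (-(-m)) :=
    integrable_one_add_norm (by rw [Module.finrank_fin_fun]; linarith)
  rw [neg_neg] at h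
  refine (h.const_mul C).mono' (hf.continuous.comp (by fun_prop)).aestronglyMeasurable
    (.of_forall fun p => (hC (q, p)).trans ?_)
  refine mul_le_mul_of_nonneg_left ?_ hC0
  refine Real.rpow_le_rpow_of_nonpos (by positivity) ?_ hm0
  gcongr
  exact le_max_right _ _

/-- The plane wave `p ↦ exp (-i p·r/ħ)`. -/
def planeWave (hbar : ℝ) (r p : Fin n → ℝ) : ℂ :=
  Complex.exp (-(Complex.I * (((p ⬝ᵥ r) / hbar : ℝ) : ℂ)))

theorem norm_planeWave (hbar : ℝ) (r p : Fin n → ℝ) : ‖planeWave hbar r p‖ = 1 := by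
  rw [planeWave, ← mul_neg, mul_comm, ← ofReal_neg, norm_exp_ofReal_mul_I]

theorem continuous_uncurry_planeWave (hbar : ℝ) :
    Continuous (Function.uncurry (planeWave (n := n) hbar)) := by
  unfold Function.uncurry planeWave dotProduct
  fun_prop

theorem continuous_planeWave (hbar : ℝ) (r : Fin n → ℝ) : Continuous (planeWave hbar r) :=
  (continuous_uncurry_planeWave hbar).comp (Continuous.prodMk_right r)

theorem hasLineDerivAt_planeWave {hbar : ℝ} (hhbar : hbar ≠ 0) (r p : Fin n → ℝ) (j : Fin n) :
    HasLineDerivAt ℝ (planeWave hbar r) (-(I * r j) * planeWave hbar r p) p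
      (hbar • Pi.single j 1) := by
  have h : ∀ t : ℝ, planeWave hbar r (p + t • (hbar • Pi.single j 1)) =
      Complex.exp (-(I * (((p ⬝ᵥ r) / hbar : ℝ) : ℂ)) + (t : ℂ) * -(I * r j)) := fun t => by
    rw [planeWave, add_dotProduct, smul_dotProduct, smul_dotProduct, single_one_dotProduct]
    congr 1
    simp only [smul_eq_mul]
    have : (hbar : ℂ) ≠ 0 := by exact_mod_cast hhbar
    push_cast
    field_simp
    ring
  unfold HasLineDerivAt
  simp only [h]
  have h1 : HasDerivAt (fun t : ℝ => (t : ℂ)) 1 (0 : ℝ) := (hasDerivAt_id (0 : ℝ)).ofReal_comp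
  refine (((h1.mul_const (-(I * r j))).const_add _).cexp).congr_deriv ?_
  simp only [planeWave, ofReal_zero, zero_mul, add_zero, one_mul]
  exact mul_comm _ _

theorem integral_planeWave_mul_oneAddDeriv {hbar m : ℝ} (hhbar : hbar ≠ 0) (hm : m < -n)
    {f : Phase n → ℂ} (hf : IsSymbol m f) (j : Fin n) (q r : Fin n → ℝ) :
    (1 + I * r j) * ∫ p, planeWave hbar r p * f (q, p) =
      ∫ p, planeWave hbar r p * oneAddDeriv (0, hbar • Pi.single j 1) f (q, p) := by
  have hfi := hf.integrable_mk_left hm q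
  have hgi := (hf.oneAddDeriv (0, hbar • Pi.single j 1)).integrable_mk_left hm q
  have hmul : ∀ g : (Fin n → ℝ) → ℂ, Integrable g →
      Integrable fun p => planeWave hbar r p * g p := fun g hg =>
    hg.bdd_mul (continuous_planeWave hbar r).aestronglyMeasurable
      (.of_forall fun p => (norm_planeWave hbar r p).le)
  have hdi : Integrable fun p => fderiv ℝ f (q, p) (0, hbar • Pi.single j 1) := by
    refine (hgi.sub hfi).congr (.of_forall fun p => ?_)
    simp [oneAddDeriv]
  have hd : ∀ p, HasLineDerivAt ℝ (fun p => f (q, p))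
      (fderiv ℝ f (q, p) (0, hbar • Pi.single j 1)) p (hbar • Pi.single j 1) := fun p => by
    have := (hf.differentiable (q, p)).hasFDerivAt.hasLineDerivAt (0, hbar • Pi.single j 1)
    simpa [HasLineDerivAt] using this
  have key := integral_bilinear_hasLineDerivAt_right_eq_neg_left_of_integrable
    (μ := (volume : Measure (Fin n → ℝ))) (B := ContinuousLinearMap.mul ℝ ℂ)
    (f := planeWave hbar r) (g := fun p => f (q, p))
    (by
      refine ((hmul _ hfi).const_mul (-(I * r j))).congr (.of_forall fun p => ?_)
      simp [mul_assoc])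
    (hmul _ hdi) (hmul _ hfi)
    (fun p _ => hasLineDerivAt_planeWave hhbar r p j) (fun p _ => hd p)
  simp only [ContinuousLinearMap.mul_apply'] at key
  simp only [oneAddDeriv, mul_add]
  rw [integral_add (hmul _ hfi) (hmul _ hdi), key, ← integral_neg]
  simp only [mul_assoc, integral_const_mul, neg_mul, neg_neg]
  ring

theorem IsSymbol.exists_integral_planeWave {hbar m : ℝ} (hhbar : hbar ≠ 0) (hm : m < -n)
    {f : Phase n → ℂ} (hf : IsSymbol m f) (k : ℕ) : ∃ g : Phase n → ℂ, IsSymbol m g ∧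
      ∀ q r : Fin n → ℝ, (∏ j, (1 + I * r j) ^ k) * ∫ p, planeWave hbar r p * f (q, p) =
        ∫ p, planeWave hbar r p * g (q, p) := by
  have hpow : ∀ (j : Fin n) (k : ℕ) {f : Phase n → ℂ}, IsSymbol m f → ∃ g : Phase n → ℂ,
      IsSymbol m g ∧ ∀ q r : Fin n → ℝ, (1 + I * r j) ^ k * ∫ p, planeWave hbar r p * f (q, p) =
        ∫ p, planeWave hbar r p * g (q, p) := fun j k => by
    induction k with
    | zero => exact fun {f} hf => ⟨f, hf, by simp⟩
    | succ k ih =>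
      intro f hf
      obtain ⟨g, hg, h⟩ := ih hf
      refine ⟨_, hg.oneAddDeriv (0, hbar • Pi.single j 1), fun q r => ?_⟩
      rw [← integral_planeWave_mul_oneAddDeriv hhbar hm hg, ← h]
      ring
  have hprod : ∀ s : Finset (Fin n), ∃ g : Phase n → ℂ, IsSymbol m g ∧
      ∀ q r : Fin n → ℝ, (∏ j ∈ s, (1 + I * r j) ^ k) * ∫ p, planeWave hbar r p * f (q, p) =
        ∫ p, planeWave hbar r p * g (q, p) := fun s => by
    induction s using Finset.induction_on with
    | empty => exact ⟨f, hf, by simp⟩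
    | insert j s hj ih =>
      obtain ⟨g, hg, h⟩ := ih
      obtain ⟨g', hg', h'⟩ := hpow j k hg
      refine ⟨g', hg', fun q r => ?_⟩
      rw [Finset.prod_insert hj, mul_assoc, h, h']
  exact hprod Finset.univ

/-- The oscillatory integral of a symbol, up to inverse powers of `1 + i r`, as an integral against
translates of products of Gamma densities. -/
theorem IsSymbol.exists_integral_planeWave_gammaDensity {hbar m : ℝ} (hhbar : hbar ≠ 0)
    (hm : m < -n) {f : Phase n → ℂ} (hf : IsSymbol m f) (k : ℕ) :
    ∃ b : Phase n → ℂ, IsSymbol m b ∧ ∀ x y : Fin n → ℝ,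
      (∏ j, (1 + I * (x j - y j)) ^ k) *
          ∫ p, planeWave hbar (x - y) p * f ((x + y) / 2, p) =
        ∫ p, planeWave hbar (x - y) p *
          ∫ t : Fin n → ℝ, (∏ j, (gammaDensity (x j + y j - t j) : ℂ)) *
            b ((2⁻¹ : ℝ) • t, p) := by
  have hm0 : m ≤ 0 := by linarith [(Nat.cast_nonneg n : (0 : ℝ) ≤ n)]
  obtain ⟨g, hg, hfg⟩ := hf.exists_integral_planeWave hhbar hm k
  obtain ⟨b, hb, hgb⟩ := hg.exists_eq_integral_gammaDensity hm0 n
    (fun j => ((2⁻¹ : ℝ) • Pi.single j 1, 0))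
  refine ⟨b, hb, fun x y => ?_⟩
  have h := hfg ((x + y) / 2) (x - y)
  simp only [Pi.sub_apply, ofReal_sub] at h
  rw [h]
  refine integral_congr_ae (.of_forall fun p => ?_)
  simp only [hgb]
  rw [← integral_sub_left_eq_self _ volume (x + y)]
  congr 2 with t
  congr 1
  congr 1
  have : ∑ j, (x + y - t) j • (((2⁻¹ : ℝ) • Pi.single j 1, 0) : Phase n) =
      ((2⁻¹ : ℝ) • (x + y - t), 0) := by
    ext i
    · simp [Prod.fst_sum, Finset.sum_apply, Pi.single_apply, mul_comm]
    · simp [Prod.snd_sum]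
  rw [this]
  ext i
  · simp
    ring
  · simp

end OscillatoryIntegral

section GammaKernel

/-- The one-dimensional kernel `γ (x + y) (1 + i (x - y))⁻⁴`. -/
def gammaKernel (x y : ℝ) : ℂ := gammaDensity (x + y) * ((1 + I * (x - y)) ^ 4)⁻¹

/-- The left factor of `gammaKernel`. -/
def gammaKernelLeft (s x : ℝ) : ℂ :=
  if s ≤ x then (((1 + s ^ 2)⁻¹ * Real.exp (s - x) : ℝ) : ℂ) else 0

/-- The right factor of `gammaKernel`. -/
def gammaKernelRight (s y : ℝ) : ℂ :=
  ((1 + s ^ 2 : ℝ) : ℂ) * (gammaKernel s y + (gammaDensityDeriv (s + y) *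
    ((1 + I * (s - y)) ^ 4)⁻¹ - 4 * I * gammaDensity (s + y) * ((1 + I * (s - y)) ^ 5)⁻¹))

theorem one_add_I_mul_ne_zero (r : ℝ) : (1 + I * r : ℂ) ≠ 0 := fun h => by
  simpa using congrArg re h

theorem norm_one_add_I_mul_sq (r : ℝ) : ‖(1 + I * r : ℂ)‖ ^ 2 = 1 + r ^ 2 := by
  rw [← normSq_eq_norm_sq, normSq_apply]
  simp
  ring

theorem hasDerivAt_gammaKernel (s y : ℝ) :
    HasDerivAt (fun s => gammaKernel s y) (gammaDensityDeriv (s + y) *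
    ((1 + I * (s - y)) ^ 4)⁻¹ - 4 * I * gammaDensity (s + y) * ((1 + I * (s - y)) ^ 5)⁻¹) s := by
  have h0 : (1 + I * (s - y) : ℂ) ≠ 0 := by
    rw [← ofReal_sub]; exact one_add_I_mul_ne_zero _
  have h1 : HasDerivAt (fun s : ℝ => ((gammaDensity (s + y) : ℝ) : ℂ))
      (gammaDensityDeriv (s + y) : ℝ) s :=
    ((hasDerivAt_gammaDensity (s + y)).comp_add_const s y).ofReal_comp
  have h2 : HasDerivAt (fun s : ℝ => (1 + I * (s - y) : ℂ)) I s := by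
    have h3 : HasDerivAt (fun s : ℝ => (s : ℂ)) 1 s := (hasDerivAt_id s).ofReal_comp
    simpa using ((h3.sub_const (y : ℂ)).const_mul I).const_add 1
  refine (h1.mul ((h2.pow 4).inv (pow_ne_zero 4 h0))).congr_deriv ?_
  simp only [Pi.pow_apply, Pi.inv_apply]
  field_simp
  ring

theorem exists_gammaKernelRight_le : ∃ C : ℝ, 0 ≤ C ∧ ∀ s y,
    ‖gammaKernelRight s y‖ ≤ C * (1 + s ^ 2 + y ^ 2)⁻¹ ∧
      ‖gammaKernel s y‖ ≤ C := by
  obtain ⟨C, hC0, hC⟩ := exists_gammaDensity_le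
  refine ⟨6 * C, by positivity, fun s y => ?_⟩
  obtain ⟨hC1, hC2⟩ := hC (s + y)
  set w : ℂ := 1 + I * (s - y) with hw
  have hw2 : ‖w‖ ^ 2 = 1 + (s - y) ^ 2 := by
    rw [hw, ← ofReal_sub, norm_one_add_I_mul_sq]
  have hw1 : 1 ≤ ‖w‖ := by nlinarith [norm_nonneg w, sq_nonneg (s - y)]
  set S : ℝ := ((1 + (s + y) ^ 2) ^ 2)⁻¹ with hS
  have hS0 : 0 ≤ S := by positivity
  have hS1 : S ≤ 1 := inv_le_one_of_one_le₀ (by nlinarith [sq_nonneg (s + y)])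
  have e4 : ‖(w ^ 4)⁻¹‖ = ((1 + (s - y) ^ 2) ^ 2)⁻¹ := by
    rw [norm_inv, norm_pow, ← hw2]; ring
  have e5 : ‖(w ^ 5)⁻¹‖ ≤ ‖(w ^ 4)⁻¹‖ := by
    rw [norm_inv, norm_inv, norm_pow, norm_pow]
    exact inv_anti₀ (by positivity) (pow_le_pow_right₀ hw1 (by norm_num))
  have e41 : ‖(w ^ 4)⁻¹‖ ≤ 1 := by
    rw [e4]; exact inv_le_one_of_one_le₀ (by nlinarith [sq_nonneg (s - y)])
  have hk : ‖gammaKernel s y‖ ≤ C * S * ‖(w ^ 4)⁻¹‖ := by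
    rw [gammaKernel, norm_mul, norm_real, Real.norm_eq_abs]
    gcongr
  have hd : ‖(gammaDensityDeriv (s + y) : ℂ) * (w ^ 4)⁻¹‖ ≤ C * S * ‖(w ^ 4)⁻¹‖ := by
    rw [norm_mul, norm_real, Real.norm_eq_abs]
    gcongr
  have hd' : ‖4 * I * (gammaDensity (s + y) : ℂ) * (w ^ 5)⁻¹‖ ≤ 4 * (C * S * ‖(w ^ 4)⁻¹‖) := by
    rw [norm_mul, norm_mul, norm_mul, norm_I, norm_real, Real.norm_eq_abs, mul_one,
      ← mul_assoc 4]
    norm_num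
    rw [mul_assoc, mul_assoc]
    simp only [norm_inv, norm_pow] at e5
    gcongr
  constructor
  · have hsum : ‖gammaKernel s y + ((gammaDensityDeriv (s + y) : ℂ) * (w ^ 4)⁻¹ -
        4 * I * gammaDensity (s + y) * (w ^ 5)⁻¹)‖ ≤ 6 * C * (S * ‖(w ^ 4)⁻¹‖) := by
      refine (norm_add_le _ _).trans ?_
      have := norm_sub_le ((gammaDensityDeriv (s + y) : ℂ) * (w ^ 4)⁻¹)
        (4 * I * gammaDensity (s + y) * (w ^ 5)⁻¹)
      linarith
    have hT : S * ‖(w ^ 4)⁻¹‖ ≤ ((1 + s ^ 2 + y ^ 2) ^ 2)⁻¹ := by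
      rw [e4, hS, ← mul_inv, ← mul_pow]
      refine inv_anti₀ (by positivity) (pow_le_pow_left₀ (by positivity) ?_ 2)
      nlinarith [mul_nonneg (sq_nonneg (s + y)) (sq_nonneg (s - y)), sq_nonneg s, sq_nonneg y]
    rw [gammaKernelRight, norm_mul, norm_real, Real.norm_of_nonneg (by positivity)]
    calc (1 + s ^ 2) * _ ≤ (1 + s ^ 2 + y ^ 2) * (6 * C * ((1 + s ^ 2 + y ^ 2) ^ 2)⁻¹) := by
          refine mul_le_mul (by nlinarith [sq_nonneg y]) (hsum.trans ?_) (norm_nonneg _)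
            (by positivity)
          gcongr
      _ = 6 * C * (1 + s ^ 2 + y ^ 2)⁻¹ := by
          field_simp
  · calc ‖gammaKernel s y‖ ≤ C * S * ‖(w ^ 4)⁻¹‖ := hk
      _ ≤ C * 1 * 1 := by gcongr
      _ ≤ 6 * C := by linarith

theorem norm_gammaKernelLeft_le (s x : ℝ) : ‖gammaKernelLeft s x‖ ≤ (1 + s ^ 2)⁻¹ := by
  unfold gammaKernelLeft
  split_ifs with h
  · rw [norm_real, Real.norm_of_nonneg (by positivity)]
    exact mul_le_of_le_one_right (by positivity) (Real.exp_le_one_iff.2 (by linarith))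
  · simp only [norm_zero]; positivity

theorem measurable_gammaKernelLeft : Measurable (Function.uncurry gammaKernelLeft) := by
  unfold Function.uncurry gammaKernelLeft
  exact Measurable.ite (measurableSet_le measurable_fst measurable_snd) (by fun_prop)
    measurable_const

theorem measurable_gammaKernelRight : Measurable (Function.uncurry gammaKernelRight) := by
  have h1 := continuous_gammaDensity.measurable
  have h2 := measurable_gammaDensityDeriv
  unfold Function.uncurry gammaKernelRight gammaKernel
  fun_prop

theorem exists_norm_gammaKernelLeft_mul_right_le : ∃ C : ℝ, 0 ≤ C ∧ ∀ s x y,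
    ‖gammaKernelLeft s x * gammaKernelRight s y‖ ≤ C * (1 + s ^ 2)⁻¹ := by
  obtain ⟨C, hC0, hC⟩ := exists_gammaKernelRight_le
  refine ⟨C, hC0, fun s x y => ?_⟩
  rw [norm_mul, mul_comm C]
  refine mul_le_mul (norm_gammaKernelLeft_le s x) ((hC s y).1.trans ?_) (norm_nonneg _)
    (by positivity)
  exact mul_le_of_le_one_right hC0
    (inv_le_one_of_one_le₀ (by nlinarith [sq_nonneg s, sq_nonneg y]))

theorem integrable_gammaKernelLeft_mul_right (x y : ℝ) :
    Integrable fun s => gammaKernelLeft s x * gammaKernelRight s y := by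
  obtain ⟨C, hC0, hC⟩ := exists_norm_gammaKernelLeft_mul_right_le
  exact (integrable_inv_one_add_sq.const_mul C).mono'
    ((measurable_gammaKernelLeft.comp measurable_prodMk_right).mul
      (measurable_gammaKernelRight.comp measurable_prodMk_right)).aestronglyMeasurable
    (.of_forall fun s => hC s x y)

theorem integral_gammaKernelLeft_mul_right (x y : ℝ) :
    ∫ s, gammaKernelLeft s x * gammaKernelRight s y = gammaKernel x y := by
  obtain ⟨C, hC0, hC⟩ := exists_gammaKernelRight_le
  have hd : ∀ s : ℝ, HasDerivAt (fun s : ℝ => (Real.exp (s - x) : ℂ) * gammaKernel s y)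
      ((((1 + s ^ 2)⁻¹ * Real.exp (s - x) : ℝ) : ℂ) * gammaKernelRight s y) s := fun s => by
    have h1 : HasDerivAt (fun s : ℝ => (Real.exp (s - x) : ℂ)) (Real.exp (s - x) : ℝ) s := by
      simpa using (((hasDerivAt_id s).sub_const x).exp).ofReal_comp
    refine (h1.mul (hasDerivAt_gammaKernel s y)).congr_deriv ?_
    have h2 : ((1 + s ^ 2 : ℝ) : ℂ) ≠ 0 := by
      exact_mod_cast (by positivity : (1 + s ^ 2 : ℝ) ≠ 0)
    rw [gammaKernelRight, ofReal_mul, ofReal_inv]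
    field_simp
  have heq : ∀ s ∈ Set.Iic x, gammaKernelLeft s x * gammaKernelRight s y =
      (((1 + s ^ 2)⁻¹ * Real.exp (s - x) : ℝ) : ℂ) * gammaKernelRight s y := fun s hs => by
    have : s ≤ x := hs
    simp only [gammaKernelLeft, this, if_true]
  have hlim : Filter.Tendsto (fun s : ℝ => (Real.exp (s - x) : ℂ) * gammaKernel s y)
      Filter.atBot (nhds 0) := by
    have h : Filter.Tendsto (fun s : ℝ => Real.exp (s - x) * C) Filter.atBot (nhds (0 * C)) :=
      (Real.tendsto_exp_atBot.comp
        (Filter.tendsto_atBot_add_const_right _ (-x) Filter.tendsto_id)).mul_const C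
    rw [zero_mul] at h
    refine squeeze_zero_norm (fun s => ?_) h
    rw [norm_mul, norm_real, Real.norm_of_nonneg (Real.exp_pos _).le]
    gcongr
    exact (hC s y).2
  have h := integral_Iic_of_hasDerivAt_of_tendsto' (a := x) (fun s _ => hd s)
    ((integrable_gammaKernelLeft_mul_right x y).integrableOn.congr_fun heq measurableSet_Iic) hlim
  rw [← setIntegral_congr_fun measurableSet_Iic heq,
    setIntegral_eq_integral_of_forall_compl_eq_zero] at h
  · rw [h]; simp
  · intro s hs
    have : ¬ s ≤ x := hs
    simp [gammaKernelLeft, this]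

theorem integrable_norm_sq_gammaKernelRight :
    Integrable fun p : ℝ × ℝ => ‖gammaKernelRight p.1 p.2‖ ^ 2 := by
  obtain ⟨C, hC0, hC⟩ := exists_gammaKernelRight_le
  refine ((integrable_inv_one_add_sq.mul_prod integrable_inv_one_add_sq).const_mul (C ^ 2)).mono'
    (measurable_gammaKernelRight.norm.pow_const 2).aestronglyMeasurable (.of_forall fun p => ?_)
  rw [Real.norm_of_nonneg (by positivity)]
  refine (pow_le_pow_left₀ (norm_nonneg _) (hC p.1 p.2).1 2).trans ?_
  rw [mul_pow, ← mul_inv, inv_pow]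
  refine mul_le_mul_of_nonneg_left (inv_anti₀ (by positivity) ?_) (by positivity)
  nlinarith [sq_nonneg p.1, sq_nonneg p.2, mul_nonneg (sq_nonneg p.1) (sq_nonneg p.2)]

theorem integrable_norm_sq_gammaKernelLeft :
    Integrable fun p : ℝ × ℝ => ‖gammaKernelLeft p.1 p.2‖ ^ 2 := by
  have hsec : ∀ s : ℝ, Integrable fun x : ℝ => if s ≤ x then Real.exp (s - x) else 0 := fun s => by
    have h : IntegrableOn (fun x : ℝ => Real.exp (-x)) (Set.Ici 0) :=
      (integrableOn_Ici_iff_integrableOn_Ioi (by simp)).2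
        (by simpa using exp_neg_integrableOn_Ioi 0 one_pos)
    have h' := (h.integrable_indicator measurableSet_Ici).comp_sub_right s
    refine h'.congr (.of_forall fun x => ?_)
    simp [Set.indicator_apply]
  have hshear : MeasurePreserving (fun p : ℝ × ℝ => (p.1, p.2 - p.1))
      (volume.prod volume) (volume.prod volume) :=
    (MeasurePreserving.id volume).skew_product (g := fun s x => x - s) (by fun_prop)
      (.of_forall fun s => (measurePreserving_sub_right volume s).map_eq)
  have h := hshear.integrable_comp_of_integrable (integrable_inv_one_add_sq.mul_prod (hsec 0))
  refine h.mono' (measurable_gammaKernelLeft.norm.pow_const 2).aestronglyMeasurable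
    (.of_forall fun p => ?_)
  rw [Real.norm_of_nonneg (by positivity), pow_two]
  refine (mul_le_mul_of_nonneg_left ((norm_gammaKernelLeft_le p.1 p.2).trans
    (inv_le_one_of_one_le₀ (by nlinarith [sq_nonneg p.1]))) (norm_nonneg _)).trans ?_
  simp only [mul_one, Function.comp_apply, gammaKernelLeft, sub_nonneg, zero_sub, neg_sub]
  split_ifs with h
  · rw [norm_real, Real.norm_of_nonneg (by positivity)]
  · simp

end GammaKernel

section Factorization

variable {n : ℕ}

theorem integrable_prod_norm_sq {h : ℝ → ℝ → ℂ}
    (hi : Integrable fun p : ℝ × ℝ => ‖h p.1 p.2‖ ^ 2) (n : ℕ) :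
    Integrable fun q : (Fin n → ℝ) × (Fin n → ℝ) => ∏ j, ‖h (q.1 j) (q.2 j)‖ ^ 2 := by
  have h1 : Integrable fun q : Fin n → ℝ × ℝ => ∏ j, ‖h (q j).1 (q j).2‖ ^ 2 :=
    Integrable.fintype_prod (f := fun (_ : Fin n) (p : ℝ × ℝ) => ‖h p.1 p.2‖ ^ 2)
      (μ := fun _ => (volume : Measure (ℝ × ℝ))) fun _ => hi
  have h2 := ((volume_measurePreserving_arrowProdEquivProdArrow ℝ ℝ (Fin n)).symm
    _).integrable_comp_of_integrable h1
  refine h2.congr (.of_forall fun q => ?_)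
  simp only [Function.comp_apply]
  rfl

/-- Tensor products of the one-dimensional kernel `h`, translated and modulated. -/
def wavePacket (hbar : ℝ) (φ : Phase n → ℂ) (h : ℝ → ℝ → ℂ) (ω : Phase n × (Fin n → ℝ))
    (x : Fin n → ℝ) : ℂ :=
  φ ω.1 * planeWave hbar x ω.1.2 * ∏ j, h (ω.2 j) (x j - 2⁻¹ * ω.1.1 j)

theorem measurable_wavePacket (hbar : ℝ) {φ : Phase n → ℂ} (hφ : Measurable φ) {h : ℝ → ℝ → ℂ}
    (hh : Measurable (Function.uncurry h)) :
    Measurable (Function.uncurry (wavePacket hbar φ h)) := by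
  unfold Function.uncurry wavePacket
  refine ((hφ.comp (by fun_prop)).mul
    ((continuous_uncurry_planeWave (n := n) hbar).measurable.comp
      (measurable_snd.prodMk (measurable_snd.comp (measurable_fst.comp measurable_fst))))).mul ?_
  refine Finset.measurable_prod _ fun j _ => hh.comp (Measurable.prodMk ?_ ?_) <;> fun_prop

theorem integrable_norm_sq_wavePacket (hbar : ℝ) {φ : Phase n → ℂ}
    (hφ : Integrable fun z => ‖φ z‖ ^ 2) {h : ℝ → ℝ → ℂ}
    (hi : Integrable fun p : ℝ × ℝ => ‖h p.1 p.2‖ ^ 2) :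
    Integrable fun p : (Phase n × (Fin n → ℝ)) × (Fin n → ℝ) =>
      ‖wavePacket hbar φ h p.1 p.2‖ ^ 2 := by
  have h1 : Integrable fun p : Phase n × ((Fin n → ℝ) × (Fin n → ℝ)) =>
      ‖φ p.1‖ ^ 2 * ∏ j, ‖h (p.2.1 j) (p.2.2 j)‖ ^ 2 :=
    hφ.mul_prod (integrable_prod_norm_sq hi n)
  have h2 := (volume_preserving_prodAssoc
    (α₁ := Phase n) (β₁ := Fin n → ℝ) (γ₁ := Fin n → ℝ)).integrable_comp_of_integrable h1
  have hshear : MeasurePreserving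
      (fun p : (Phase n × (Fin n → ℝ)) × (Fin n → ℝ) => (p.1, p.2 - (2⁻¹ : ℝ) • p.1.1.1))
      (volume.prod volume) (volume.prod volume) :=
    (MeasurePreserving.id volume).skew_product
      (g := fun (ω : Phase n × (Fin n → ℝ)) x => x - (2⁻¹ : ℝ) • ω.1.1) (by fun_prop)
      (.of_forall fun ω => (measurePreserving_sub_right volume ((2⁻¹ : ℝ) • ω.1.1)).map_eq)
  refine (hshear.integrable_comp_of_integrable h2).congr (.of_forall fun p => ?_)
  simp [wavePacket, norm_planeWave, mul_pow, Finset.prod_pow, MeasurableEquiv.prodAssoc]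

theorem planeWave_mul_planeWave_neg (hbar : ℝ) (x y p : Fin n → ℝ) :
    planeWave hbar x p * planeWave (-hbar) y p = planeWave hbar (x - y) p := by
  rw [planeWave, planeWave, planeWave, ← Complex.exp_add, dotProduct_sub]
  congr 1
  push_cast
  rw [div_neg]
  ring

theorem IsSymbol.exists_norm_scale_le {m : ℝ} (hm : m ≤ 0) {b : Phase n → ℂ} (hb : IsSymbol m b) :
    ∃ C : ℝ, 0 ≤ C ∧ ∀ z : Phase n, ‖b ((2⁻¹ : ℝ) • z.1, z.2)‖ ≤ C * (1 + ‖z‖) ^ m := by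
  obtain ⟨C, hC0, hC⟩ := hb.exists_norm_le
  refine ⟨C * (2⁻¹ : ℝ) ^ m, by positivity, fun z => (hC _).trans ?_⟩
  rw [mul_assoc, ← Real.mul_rpow (by positivity) (by positivity)]
  refine mul_le_mul_of_nonneg_left (Real.rpow_le_rpow_of_nonpos (by positivity) ?_ hm) hC0
  have h : 2⁻¹ * ‖z‖ ≤ ‖(((2⁻¹ : ℝ) • z.1, z.2) : Phase n)‖ := by
    rw [Prod.norm_def, Prod.norm_def, mul_max_of_nonneg _ _ (by norm_num)]
    refine max_le_max (by simp [norm_smul]) ?_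
    linarith [norm_nonneg z.2]
  linarith

theorem integrable_one_add_norm_rpow {m : ℝ} (hm : m < -(2 * n)) :
    Integrable fun z : Phase n => (1 + ‖z‖) ^ m := by
  have : (volume : Measure (Phase n)).IsAddHaarMeasure :=
    Measure.prod.instIsAddHaarMeasure _ _
  have h := integrable_one_add_norm (E := Phase n) (μ := volume) (r := -m)
    (by rw [Module.finrank_prod, Module.finrank_fin_fun]; push_cast; linarith)
  simpa using h

/-- The Weyl kernel of a symbol of order `m < -2n` is an `L²` superposition of rank one kernels. -/
theorem IsSymbol.exists_weylKernel_factorization {hbar m : ℝ} (hhbar : 0 < hbar)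
    (hm : m < -(2 * n)) {a : Phase n → ℂ} (ha : IsSymbol m a) :
    ∃ U V : Phase n × (Fin n → ℝ) → (Fin n → ℝ) → ℂ,
      StronglyMeasurable (Function.uncurry U) ∧ StronglyMeasurable (Function.uncurry V) ∧
      Integrable (fun p : (Phase n × (Fin n → ℝ)) × (Fin n → ℝ) => ‖U p.1 p.2‖ ^ 2) ∧
      Integrable (fun p : (Phase n × (Fin n → ℝ)) × (Fin n → ℝ) => ‖V p.1 p.2‖ ^ 2) ∧
      ∀ x y, weylKernel n hbar a x y = ∫ ω, U ω x * V ω y := by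
  have hn : (0 : ℝ) ≤ n := Nat.cast_nonneg n
  have hm0 : m ≤ 0 := by linarith
  obtain ⟨b, hb, hab⟩ := ha.exists_integral_planeWave_gammaDensity hhbar.ne' (by linarith) 4
  obtain ⟨C, hC0, hC⟩ := hb.exists_norm_scale_le hm0
  obtain ⟨D, hD0, hD⟩ := exists_norm_gammaKernelLeft_mul_right_le
  have hρ := integrable_one_add_norm_rpow (n := n) hm
  set c : ℂ := (((2 * Real.pi * hbar) ^ n : ℂ))⁻¹ with hc
  set φ : Phase n → ℂ := fun z => (((1 + ‖z‖) ^ (m / 2) : ℝ) : ℂ) with hφ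
  set B : Phase n → ℂ := fun z => b ((2⁻¹ : ℝ) • z.1, z.2) with hB
  set ψ : Phase n → ℂ := fun z => c * B z * (((1 + ‖z‖) ^ (-(m / 2)) : ℝ) : ℂ) with hψ
  have hBc : Continuous B := hb.continuous.comp (by fun_prop)
  have hφm : Measurable φ := by fun_prop
  have hψm : Measurable ψ := (hBc.measurable.const_mul c).mul (by fun_prop)
  have hpos : ∀ z : Phase n, 0 < 1 + ‖z‖ := fun z => by positivity
  have hφψ : ∀ z, φ z * ψ z = c * B z := fun z => by
    have h : (((1 + ‖z‖) ^ (m / 2) : ℝ) : ℂ) * (((1 + ‖z‖) ^ (-(m / 2)) : ℝ) : ℂ) = 1 := by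
      rw [← ofReal_mul, ← Real.rpow_add (hpos z)]; simp
    simp only [hφ, hψ]
    linear_combination c * B z * h
  have hBi : Integrable B :=
    (hρ.const_mul C).mono' hBc.aestronglyMeasurable (.of_forall hC)
  have hφi : Integrable fun z => ‖φ z‖ ^ 2 := by
    refine hρ.congr (.of_forall fun z => ?_)
    simp only [hφ]
    rw [norm_real, Real.norm_of_nonneg (by have := hpos z; positivity), ← Real.rpow_mul_natCast
      (hpos z).le]
    congr 1
    push_cast
    ring
  have hψi : Integrable fun z => ‖ψ z‖ ^ 2 := by
    refine (hφi.const_mul ((‖c‖ * C) ^ 2)).mono' (hψm.norm.pow_const 2).aestronglyMeasurable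
      (.of_forall fun z => ?_)
    rw [Real.norm_of_nonneg (by positivity), ← mul_pow]
    refine pow_le_pow_left₀ (norm_nonneg _) ?_ 2
    have hp : 0 ≤ (1 + ‖z‖) ^ (-(m / 2)) := Real.rpow_nonneg (hpos z).le _
    have hp' : 0 ≤ (1 + ‖z‖) ^ (m / 2) := Real.rpow_nonneg (hpos z).le _
    simp only [hφ, hψ]
    rw [norm_mul, norm_mul, norm_real, norm_real, Real.norm_of_nonneg hp, Real.norm_of_nonneg hp']
    have h2 : (1 + ‖z‖) ^ m * (1 + ‖z‖) ^ (-(m / 2)) = (1 + ‖z‖) ^ (m / 2) := by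
      rw [← Real.rpow_add (hpos z)]
      congr 1
      ring
    calc ‖c‖ * ‖B z‖ * (1 + ‖z‖) ^ (-(m / 2))
        ≤ ‖c‖ * (C * (1 + ‖z‖) ^ m) * (1 + ‖z‖) ^ (-(m / 2)) := by
          gcongr
          exact hC z
      _ = ‖c‖ * C * (1 + ‖z‖) ^ (m / 2) := by rw [← h2]; ring
  refine ⟨wavePacket hbar φ gammaKernelLeft, wavePacket (-hbar) ψ gammaKernelRight,
    (measurable_wavePacket _ hφm measurable_gammaKernelLeft).stronglyMeasurable,
    (measurable_wavePacket _ hψm measurable_gammaKernelRight).stronglyMeasurable,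
    integrable_norm_sq_wavePacket _ hφi integrable_norm_sq_gammaKernelLeft,
    integrable_norm_sq_wavePacket _ hψi integrable_norm_sq_gammaKernelRight, fun x y => ?_⟩
  have hUV : ∀ ω : Phase n × (Fin n → ℝ),
      wavePacket hbar φ gammaKernelLeft ω x * wavePacket (-hbar) ψ gammaKernelRight ω y =
        c * (planeWave hbar (x - y) ω.1.2 * B ω.1) *
          ∏ j, gammaKernelLeft (ω.2 j) (x j - 2⁻¹ * ω.1.1 j) *
            gammaKernelRight (ω.2 j) (y j - 2⁻¹ * ω.1.1 j) := fun ω => by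
    rw [← planeWave_mul_planeWave_neg, Finset.prod_mul_distrib, wavePacket, wavePacket]
    linear_combination (planeWave hbar x ω.1.2 * planeWave (-hbar) y ω.1.2 *
      (∏ j, gammaKernelLeft (ω.2 j) (x j - 2⁻¹ * ω.1.1 j)) *
      ∏ j, gammaKernelRight (ω.2 j) (y j - 2⁻¹ * ω.1.1 j)) * hφψ ω.1
  have hUVi : Integrable fun ω : Phase n × (Fin n → ℝ) =>
      wavePacket hbar φ gammaKernelLeft ω x * wavePacket (-hbar) ψ gammaKernelRight ω y := by
    have h1 : Integrable fun ω : Phase n × (Fin n → ℝ) =>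
        (‖c‖ * ‖B ω.1‖) * ∏ j, D * (1 + ω.2 j ^ 2)⁻¹ :=
      (hBi.norm.const_mul ‖c‖).mul_prod
        (Integrable.fintype_prod (f := fun (_ : Fin n) s => D * (1 + s ^ 2)⁻¹)
          fun _ => integrable_inv_one_add_sq.const_mul D)
    refine h1.mono' (((measurable_wavePacket _ hφm measurable_gammaKernelLeft).comp
      measurable_prodMk_right).mul ((measurable_wavePacket _ hψm measurable_gammaKernelRight).comp
      measurable_prodMk_right)).aestronglyMeasurable (.of_forall fun ω => ?_)
    rw [hUV, norm_mul, norm_mul, norm_mul, norm_planeWave, one_mul, norm_prod]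
    gcongr
    exact hD _ _ _
  have hin : ∀ z : Phase n, ∫ σ, wavePacket hbar φ gammaKernelLeft (z, σ) x *
      wavePacket (-hbar) ψ gammaKernelRight (z, σ) y =
        c * (∏ j, (1 + I * (x j - y j)) ^ 4)⁻¹ * (planeWave hbar (x - y) z.2 *
          ((∏ j, (gammaDensity (x j + y j - z.1 j) : ℂ)) * B z)) := fun z => by
    simp only [hUV]
    rw [integral_const_mul, integral_fintype_prod_volume_eq_prod
      (fun j s => gammaKernelLeft s (x j - 2⁻¹ * z.1 j) * gammaKernelRight s (y j - 2⁻¹ * z.1 j))]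
    simp only [integral_gammaKernelLeft_mul_right]
    have : ∀ j, gammaKernel (x j - 2⁻¹ * z.1 j) (y j - 2⁻¹ * z.1 j) =
        gammaDensity (x j + y j - z.1 j) * ((1 + I * (x j - y j)) ^ 4)⁻¹ := fun j => by
      rw [gammaKernel]
      congr 3
      · ring
      · push_cast; ring
    simp only [this, Finset.prod_mul_distrib, Finset.prod_inv_distrib]
    ring
  have hP : ∏ j, (1 + I * ((x j : ℂ) - y j)) ^ 4 ≠ 0 :=
    Finset.prod_ne_zero_iff.2 fun j _ => pow_ne_zero 4 (by
      rw [← ofReal_sub]; exact one_add_I_mul_ne_zero _)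
  have hzi := hUVi.integral_prod_left
  rw [Measure.volume_eq_prod, integral_prod _ hUVi]
  simp only [hin] at hzi ⊢
  rw [Measure.volume_eq_prod, integral_prod_symm _ hzi]
  have hw : weylKernel n hbar a x y =
      c * ∫ p, planeWave hbar (x - y) p * a ((x + y) / 2, p) := by
    simp only [weylKernel, planeWave, hc]
    push_cast
    rfl
  simp only [integral_const_mul]
  rw [hw, ← hab]
  field_simp

end Factorization

theorem integral_weylKernel_self (n : ℕ) (hbar : ℝ) {a : Phase n → ℂ} (ha : Integrable a) :
    ∫ x, weylKernel n hbar a x x = ((((2 * Real.pi * hbar) ^ n)⁻¹ : ℝ) : ℂ) * ∫ z, a z := by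
  have h : ∀ x : Fin n → ℝ, (x + x) / 2 = x := fun x => by
    ext j; simp
  simp only [weylKernel, h, sub_self, dotProduct_zero, zero_div, ofReal_zero, mul_zero, neg_zero,
    Complex.exp_zero, one_mul]
  rw [integral_const_mul, Measure.volume_eq_prod, integral_prod _ ha]

/-- If `a` is a smooth symbol in the Shubin class `Γ^m_δ(ℝ²ⁿ)` with
`m < -2n` and `0 < δ ≤ 1`, then the Weyl operator `Â = Op_W(a)` (the integral operator
with kernel `K`) is a trace class operator on `L²(ℝⁿ)`: it is a bounded operator and for
every orthonormal Hilbert basis `(e_j)` of `L²(ℝⁿ)` the family `j ↦ (Âe_j|e_j)` is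
summable with sum `(2πħ)^{-n} ∫ a(z) dz`. -/
theorem toeplitz_stmt17 (n : ℕ) (hbar : ℝ) (hhbar : 0 < hbar)
    (m δ : ℝ) (hm : m < -(2 * n)) (hδ0 : 0 < δ) (hδ1 : δ ≤ 1)
    (a : Phase n → ℂ) (hsmooth : ContDiff ℝ (⊤ : ℕ∞) a)
    (hshubin : ∀ k : ℕ, ∃ C : ℝ, 0 ≤ C ∧ ∀ z : Phase n,
      ‖iteratedFDeriv ℝ k a z‖ ≤ C * (1 + ‖z‖) ^ (m - δ * k)) :
    ∃ A : Lp ℂ 2 (volume : Measure (Fin n → ℝ)) →L[ℂ] Lp ℂ 2 (volume : Measure (Fin n → ℝ)),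
      (∀ f : Lp ℂ 2 (volume : Measure (Fin n → ℝ)),
        (A f : (Fin n → ℝ) → ℂ)
          =ᵐ[volume] fun x => ∫ y : Fin n → ℝ, weylKernel n hbar a x y * f y) ∧
      (∀ (ι : Type) (e : HilbertBasis ι ℂ (Lp ℂ 2 (volume : Measure (Fin n → ℝ)))),
        HasSum
          (fun j : ι => ∫ x : Fin n → ℝ,
            (A (e j) : (Fin n → ℝ) → ℂ) x * (starRingEnd ℂ) ((e j : (Fin n → ℝ) → ℂ) x))
          (((((2 * Real.pi * hbar) ^ n)⁻¹ : ℝ) : ℂ) * ∫ z : Phase n, a z)) := by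
  have ha : IsSymbol m a := by
    refine ⟨hsmooth, fun k => ?_⟩
    obtain ⟨C, hC0, hC⟩ := hshubin k
    refine ⟨C, fun z => (hC z).trans (mul_le_mul_of_nonneg_left ?_ hC0)⟩
    have hk : 0 ≤ δ * k := by positivity
    exact Real.rpow_le_rpow_of_exponent_le (by linarith [norm_nonneg z]) (by linarith)
  have hai : Integrable a := by
    obtain ⟨C, hC0, hC⟩ := ha.exists_norm_le
    exact ((integrable_one_add_norm_rpow hm).const_mul C).mono'
      ha.continuous.aestronglyMeasurable (.of_forall hC)
  obtain ⟨U, V, hUm, hVm, hU, hV, hK⟩ := ha.exists_weylKernel_factorization hhbar hm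
  have : Fact ((2 : ENNReal) ≠ ⊤) := ⟨ENNReal.ofNat_ne_top⟩
  obtain ⟨A, hA, hAt⟩ := exists_clm_hasSum_trace_of_factorization hUm hVm hU hV hK
  refine ⟨A, hA, fun ι e => ?_⟩
  rw [← integral_weylKernel_self n hbar hai]
  exact hAt ι e
end
end
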